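/- arXiv:1108.4856 — 4 statements merged into one kernel-verified Lean document; each statement's English description precedes it below -/
import Mathlib

section
/- Let K be a convex body in ℝⁿ with barycenter at the origin such that N(K, B₂ⁿ) ≤ exp(A₁ n) and vr(K) ≥ a₁ > 0. Then N(K°, B₂ⁿ) ≤ exp(A₂ n) with A₂ = A₁ + log(C/a₁) for a universal constant C > 0. -/
open MeasureTheory Real
open scoped RealInnerProductSpace Pointwise

namespace CovPolar

/-- Short name for Euclidean space. -/
abbrev E (n : ℕ) := EuclideanSpace ℝ (Fin n)

/-- Laplace transform of the indicator of `A`. -/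
noncomputable def tz {n : ℕ} (A : Set (E n)) (y : E n) : ℝ := ∫ x in A, Real.exp ⟪x, y⟫

/-- Unnormalised first moment of the tilted measure. -/
noncomputable def tm {n : ℕ} (A : Set (E n)) (y : E n) : E n := ∫ x in A, Real.exp ⟪x, y⟫ • x

/-- Mean of the tilted measure. -/
noncomputable def tmean {n : ℕ} (A : Set (E n)) (y : E n) : E n := (tz A y)⁻¹ • tm A y

theorem intOn {n : ℕ} {F : Type*} [NormedAddCommGroup F] {A : Set (E n)} (hA : IsCompact A)
    {f : E n → F} (hf : Continuous f) : Integrable f (volume.restrict A) :=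
  hf.continuousOn.integrableOn_compact hA

theorem tz_pos {n : ℕ} {A : Set (E n)} (hA : IsCompact A) (h0 : 0 < volume A) (y : E n) :
    0 < tz A y := by
  have h := intOn hA (f := fun x : E n => Real.exp ⟪x, y⟫) (by fun_prop)
  have : NeZero (volume.restrict A) := ⟨by
    rw [Ne, Measure.restrict_eq_zero]; exact h0.ne'⟩
  exact integral_exp_pos h

theorem hasFDerivAt_tz {n : ℕ} {A : Set (E n)} (hA : IsCompact A) (y : E n) :
    HasFDerivAt (tz A) (∫ x in A, Real.exp ⟪x, y⟫ • innerSL ℝ x) y := by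
  obtain ⟨R, hR⟩ := hA.isBounded.exists_norm_le
  have hm : MeasurableSet A := hA.measurableSet
  refine hasFDerivAt_integral_of_dominated_of_fderiv_le (s := Metric.ball y 1)
    (F := fun y x => Real.exp ⟪x, y⟫)
    (F' := fun y x => Real.exp ⟪x, y⟫ • innerSL ℝ x)
    (bound := fun x => Real.exp (‖x‖ * (‖y‖ + 1)) * ‖x‖) (Metric.ball_mem_nhds y one_pos) ?_ ?_ ?_ ?_ ?_ ?_
  · exact Filter.Eventually.of_forall fun z => (intOn hA (by fun_prop)).aestronglyMeasurable
  · exact intOn hA (by fun_prop)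
  · exact (intOn hA (by fun_prop)).aestronglyMeasurable
  · refine Filter.Eventually.of_forall fun x z hz => ?_
    rw [norm_smul, innerSL_apply_norm, Real.norm_eq_abs, Real.abs_exp]
    gcongr
    have : ‖z‖ ≤ ‖y‖ + 1 := by
      have h1 := norm_sub_norm_le z y
      rw [mem_ball_iff_norm] at hz
      linarith
    exact (real_inner_le_norm x z).trans (by gcongr)
  · exact intOn hA (by fun_prop)
  · refine Filter.Eventually.of_forall fun x z hz => ?_
    exact ((innerSL ℝ x).hasFDerivAt (x := z)).exp

theorem hasFDerivAt_tm {n : ℕ} {A : Set (E n)} (hA : IsCompact A) (y : E n) :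
    HasFDerivAt (tm A) (∫ x in A, (Real.exp ⟪x, y⟫ • innerSL ℝ x).smulRight x) y := by
  have hc : Continuous (fun x : E n => (Real.exp ⟪x, y⟫ • innerSL ℝ x).smulRight x) := by
    have : (fun x : E n => (Real.exp ⟪x, y⟫ • innerSL ℝ x).smulRight x) =
      fun x => ContinuousLinearMap.smulRightL ℝ (E n) (E n) (Real.exp ⟪x, y⟫ • innerSL ℝ x) x := by
      ext; rfl
    rw [this]
    fun_prop
  refine hasFDerivAt_integral_of_dominated_of_fderiv_le (s := Metric.ball y 1)
    (F := fun y x => Real.exp ⟪x, y⟫ • x)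
    (F' := fun y x => (Real.exp ⟪x, y⟫ • innerSL ℝ x).smulRight x)
    (bound := fun x => Real.exp (‖x‖ * (‖y‖ + 1)) * ‖x‖ * ‖x‖) (Metric.ball_mem_nhds y one_pos) ?_ ?_ ?_ ?_ ?_ ?_
  · exact Filter.Eventually.of_forall fun z => (intOn hA (by fun_prop)).aestronglyMeasurable
  · exact intOn hA (by fun_prop)
  · exact (intOn hA hc).aestronglyMeasurable
  · refine Filter.Eventually.of_forall fun x z hz => ?_
    rw [ContinuousLinearMap.norm_smulRight_apply, norm_smul, innerSL_apply_norm, Real.norm_eq_abs, Real.abs_exp]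
    gcongr
    have : ‖z‖ ≤ ‖y‖ + 1 := by
      have h1 := norm_sub_norm_le z y
      rw [mem_ball_iff_norm] at hz
      linarith
    exact (real_inner_le_norm x z).trans (by gcongr)
  · exact intOn hA (by fun_prop)
  · refine Filter.Eventually.of_forall fun x z hz => ?_
    exact (((innerSL ℝ x).hasFDerivAt (x := z)).exp).smul_const x

theorem exists_cov {n : ℕ} {A : Set (E n)} (hA : IsCompact A) (h0 : 0 < volume A) (y : E n) :
    ∃ S : E n →L[ℝ] E n, HasFDerivAt (tmean A) S y ∧ ∀ v w, ⟪S v, w⟫ =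
      (tz A y)⁻¹ * ∫ x in A, Real.exp ⟪x, y⟫ * (⟪x - tmean A y, v⟫ * ⟪x - tmean A y, w⟫) := by
  have hz := tz_pos hA h0 y
  have hd := ((hasDerivAt_inv hz.ne').comp_hasFDerivAt y (hasFDerivAt_tz hA y)).fun_smul (hasFDerivAt_tm hA y)
  refine ⟨_, hd, fun v w => ?_⟩
  have hc : Continuous (fun x : E n => (Real.exp ⟪x, y⟫ • innerSL ℝ x).smulRight x) := by
    have : (fun x : E n => (Real.exp ⟪x, y⟫ • innerSL ℝ x).smulRight x) =
      fun x => ContinuousLinearMap.smulRightL ℝ (E n) (E n) (Real.exp ⟪x, y⟫ • innerSL ℝ x) x := by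
      ext; rfl
    rw [this]
    fun_prop
  have e1 : ∀ v, (∫ x in A, Real.exp ⟪x, y⟫ • innerSL ℝ x) v = ⟪tm A y, v⟫ := by
    intro v
    rw [ContinuousLinearMap.integral_apply (intOn hA (by fun_prop)), real_inner_comm, tm,
      ← integral_inner (intOn hA (by fun_prop))]
    congr 1; ext x; simp [inner_smul_right, real_inner_comm]
  have e2 : ⟪(∫ x in A, (Real.exp ⟪x, y⟫ • innerSL ℝ x).smulRight x) v, w⟫ =
      ∫ x in A, Real.exp ⟪x, y⟫ * (⟪x, v⟫ * ⟪x, w⟫) := by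
    rw [ContinuousLinearMap.integral_apply (intOn hA hc), real_inner_comm,
      ← integral_inner ((intOn hA hc).apply_continuousLinearMap v)]
    congr 1; ext x; simp [inner_smul_right, real_inner_comm, mul_assoc]
  have e3 : ∀ v, ∫ x in A, Real.exp ⟪x, y⟫ * ⟪x, v⟫ = ⟪tm A y, v⟫ := by
    intro v
    rw [real_inner_comm, tm, ← integral_inner (intOn hA (by fun_prop))]
    congr 1; ext x; simp [inner_smul_right, real_inner_comm]
  have e4 : ∫ x in A, Real.exp ⟪x, y⟫ * (⟪x - tmean A y, v⟫ * ⟪x - tmean A y, w⟫) =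
      (∫ x in A, Real.exp ⟪x, y⟫ * (⟪x, v⟫ * ⟪x, w⟫)) - ⟪tmean A y, v⟫ * ⟪tm A y, w⟫
       - ⟪tmean A y, w⟫ * ⟪tm A y, v⟫ + ⟪tmean A y, v⟫ * ⟪tmean A y, w⟫ * tz A y := by
    rw [← e3 v, ← e3 w, tz, ← integral_const_mul, ← integral_const_mul, ← integral_const_mul,
      ← integral_sub (intOn hA (by fun_prop)) (intOn hA (by fun_prop)),
      ← integral_sub (intOn hA (by fun_prop)) (intOn hA (by fun_prop)),
      ← integral_add (intOn hA (by fun_prop)) (intOn hA (by fun_prop))]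
    congr 1; ext x; simp only [inner_sub_left]; ring
  rw [e4, ← e2]
  simp only [ContinuousLinearMap.add_apply, ContinuousLinearMap.smul_apply,
    ContinuousLinearMap.smulRight_apply, inner_add_left, inner_smul_left, e1, tmean, smul_eq_mul,
    ContinuousLinearMap.neg_apply]
  simp
  field_simp
  ring



theorem tmean_mem {n : ℕ} {A : Set (E n)} (hA : IsCompact A) (hc : Convex ℝ A)
    (h0 : 0 < volume A) (y : E n) : tmean A y ∈ A := by
  have hi := intOn hA (f := fun x : E n => Real.exp ⟪x, y⟫) (by fun_prop)
  have : NeZero (volume.restrict A) := ⟨by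
    rw [Ne, Measure.restrict_eq_zero]; exact h0.ne'⟩
  have hp := isProbabilityMeasure_tilted hi
  have h1 : tmean A y = ∫ x, x ∂((volume.restrict A).tilted (fun x => ⟪x, y⟫)) := by
    rw [integral_tilted, tmean, tm, ← integral_smul]
    congr 1; ext1 x
    rw [smul_smul, div_eq_inv_mul, tz]
  rw [h1]
  refine hc.integral_mem hA.isClosed ?_ ?_
  · exact (tilted_absolutelyContinuous _ _).ae_le (ae_restrict_mem hA.measurableSet)
  · rw [integrable_tilted_iff hi]
    exact intOn hA (by fun_prop)

theorem cov_pos {n : ℕ} {A : Set (E n)} (hA : IsCompact A) (h0 : 0 < volume A) (y m v : E n)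
    (hv : v ≠ 0) : 0 < ∫ x in A, Real.exp ⟪x, y⟫ * (⟪x - m, v⟫ * ⟪x - m, v⟫) := by
  rw [integral_pos_iff_support_of_nonneg]
  · have hsupp : Function.support (fun x : E n => Real.exp ⟪x, y⟫ * (⟪x - m, v⟫ * ⟪x - m, v⟫)) =
        ((AffineSubspace.mk' m (Submodule.span ℝ {v})ᗮ : AffineSubspace ℝ (E n)) : Set (E n))ᶜ := by
      ext x
      simp [AffineSubspace.mem_mk', Submodule.mem_orthogonal_singleton_iff_inner_left]
    rw [hsupp]
    have hz : volume ((AffineSubspace.mk' m (Submodule.span ℝ {v})ᗮ : AffineSubspace ℝ (E n)) : Set (E n)) = 0 := by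
      apply Measure.addHaar_affineSubspace
      intro h
      have h2 : m + v ∈ (AffineSubspace.mk' m (Submodule.span ℝ {v})ᗮ : AffineSubspace ℝ (E n)) := by
        rw [h]; trivial
      simp [AffineSubspace.mem_mk', Submodule.mem_orthogonal_singleton_iff_inner_left] at h2
      exact hv h2
    have : (volume.restrict A) (((AffineSubspace.mk' m (Submodule.span ℝ {v})ᗮ : AffineSubspace ℝ (E n)) : Set (E n))ᶜ) = (volume.restrict A) Set.univ := by
      apply measure_congr
      rw [ae_eq_univ, compl_compl]
      exact nonpos_iff_eq_zero.1 ((Measure.restrict_apply_le _ _).trans hz.le)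
    rw [this, Measure.restrict_apply_univ]
    exact h0
  · intro x
    have := mul_self_nonneg ⟪x - m, v⟫
    simp only [Pi.zero_apply]
    positivity
  · exact intOn hA (by fun_prop)

theorem gauss_int {n : ℕ} (b : OrthonormalBasis (Fin n) ℝ (E n)) (l : Fin n → ℝ) (hl : ∀ k, 0 < l k) :
    Integrable (fun x : E n => Real.exp (-(1/2) * ∑ k, ⟪b k, x⟫ ^ 2 / l k)) ∧
    ∫ x : E n, Real.exp (-(1/2) * ∑ k, ⟪b k, x⟫ ^ 2 / l k) = ∏ k, √(2 * π * l k) := by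
  have mp : MeasurePreserving (fun x : E n => (WithLp.ofLp (b.repr x) : Fin n → ℝ)) :=
    (PiLp.volume_preserving_ofLp (Fin n)).comp b.measurePreserving_repr
  have me : MeasurableEmbedding (fun x : E n => (WithLp.ofLp (b.repr x) : Fin n → ℝ)) :=
    (b.measurableEquiv.trans (MeasurableEquiv.toLp 2 (Fin n → ℝ)).symm).measurableEmbedding
  have hf : (fun x : E n => Real.exp (-(1/2) * ∑ k, ⟪b k, x⟫ ^ 2 / l k)) =
      fun x => (fun t : Fin n → ℝ => ∏ k, Real.exp (-(1 / (2 * l k)) * (t k) ^ 2)) (WithLp.ofLp (b.repr x)) := by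
    ext x
    simp only [b.repr_apply_apply]
    rw [← Real.exp_sum, Finset.mul_sum]
    congr 1
    refine Finset.sum_congr rfl fun k _ => ?_
    have := (hl k).ne'
    field_simp
  rw [hf]
  constructor
  · have hG : Integrable (fun t : Fin n → ℝ => ∏ k, Real.exp (-(1 / (2 * l k)) * (t k) ^ 2)) := ?_
    · exact (mp.integrable_comp_emb me (g := fun t : Fin n → ℝ => ∏ k, Real.exp (-(1 / (2 * l k)) * (t k) ^ 2))).2 hG
    refine Integrable.fintype_prod (f := fun k (t : ℝ) => Real.exp (-(1 / (2 * l k)) * t ^ 2)) fun k => ?_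
    exact integrable_exp_neg_mul_sq (by have := hl k; positivity)
  · refine (mp.integral_comp me (fun t : Fin n → ℝ => ∏ k, Real.exp (-(1 / (2 * l k)) * (t k) ^ 2))).trans ?_
    rw [integral_fintype_prod_volume_eq_prod (fun k (t : ℝ) => Real.exp (-(1 / (2 * l k)) * t ^ 2))]
    refine Finset.prod_congr rfl fun k _ => ?_
    rw [integral_gaussian]
    congr 1
    have := (hl k).ne'
    field_simp

/-- Gibbs inequality against a (translated) Gaussian. -/
theorem gibbs {n : ℕ} {A : Set (E n)} (hA : IsCompact A) (h0 : 0 < volume A) (y : E n)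
    (q : E n → ℝ) (hq : Continuous q) (hi : Integrable (fun x => Real.exp (- (1/2) * q x))) :
    - (1/2) * ((tz A y)⁻¹ * ∫ x in A, Real.exp ⟪x, y⟫ * q (x - tmean A y)) - ⟪tmean A y, y⟫
      + Real.log (tz A y) ≤ Real.log (∫ x, Real.exp (- (1/2) * q x)) := by
  have hz := tz_pos hA h0 y
  set m := tmean A y with hm
  set c := - (1/2) * ((tz A y)⁻¹ * ∫ x in A, Real.exp ⟪x, y⟫ * q (x - m)) - ⟪m, y⟫
      + Real.log (tz A y) with hc
  have hI : ∫ x, Real.exp (- (1/2) * q x) = ∫ x, Real.exp (- (1/2) * q (x - m)) :=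
    (integral_sub_right_eq_self (fun x => Real.exp (- (1/2) * q x)) m).symm
  have hi2 : Integrable (fun x => Real.exp (- (1/2) * q (x - m))) := hi.comp_sub_right m
  rw [hI]
  have h1 : ∫ x in A, Real.exp (- (1/2) * q (x - m)) ≤ ∫ x, Real.exp (- (1/2) * q (x - m)) :=
    setIntegral_le_integral hi2 (Filter.Eventually.of_forall fun x => (Real.exp_pos _).le)
  have e3 : ∫ x in A, Real.exp ⟪x, y⟫ * ⟪x, y⟫ = ⟪tm A y, y⟫ := by
    rw [real_inner_comm, tm, ← integral_inner (intOn hA (by fun_prop))]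
    congr 1; ext x; simp [inner_smul_right, real_inner_comm]
  have e4 : ⟪m, y⟫ = (tz A y)⁻¹ * ⟪tm A y, y⟫ := by
    rw [hm, tmean, inner_smul_left]; simp
  have h2 : ∫ x in A, Real.exp c * (tz A y)⁻¹ * ((1 + Real.log (tz A y) - c) * Real.exp ⟪x, y⟫ -
      (1/2) * (Real.exp ⟪x, y⟫ * q (x - m)) - Real.exp ⟪x, y⟫ * ⟪x, y⟫) ≤
      ∫ x in A, Real.exp (- (1/2) * q (x - m)) := by
    refine integral_mono (intOn hA (by fun_prop)) hi2.integrableOn fun x => ?_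
    have key := Real.add_one_le_exp (- (1/2) * q (x - m) - ⟪x, y⟫ + Real.log (tz A y) - c)
    have e5 : Real.exp (- (1/2) * q (x - m)) = Real.exp c * (tz A y)⁻¹ * Real.exp ⟪x, y⟫ *
      Real.exp (- (1/2) * q (x - m) - ⟪x, y⟫ + Real.log (tz A y) - c) := by
      have : (tz A y)⁻¹ = Real.exp (- Real.log (tz A y)) := by
        rw [Real.exp_neg, Real.exp_log hz]
      rw [this, ← Real.exp_add, ← Real.exp_add, ← Real.exp_add]
      congr 1; ring
    simp only
    rw [e5]
    calc _ = Real.exp c * (tz A y)⁻¹ * Real.exp ⟪x, y⟫ * (- (1/2) * q (x - m) - ⟪x, y⟫ + Real.log (tz A y) - c + 1) := by ring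
      _ ≤ _ := by gcongr
  have h3 : ∫ x in A, Real.exp c * (tz A y)⁻¹ * ((1 + Real.log (tz A y) - c) * Real.exp ⟪x, y⟫ -
      (1/2) * (Real.exp ⟪x, y⟫ * q (x - m)) - Real.exp ⟪x, y⟫ * ⟪x, y⟫) = Real.exp c := by
    rw [integral_const_mul, integral_sub (intOn hA (by fun_prop)) (intOn hA (by fun_prop)),
      integral_sub (intOn hA (by fun_prop)) (intOn hA (by fun_prop)), integral_const_mul, integral_const_mul, e3]
    have e6 : ∫ x in A, Real.exp ⟪x, y⟫ = tz A y := rfl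
    rw [e6]
    have e7 : (1 + Real.log (tz A y) - c) = 1 + (1/2) * ((tz A y)⁻¹ * ∫ x in A, Real.exp ⟪x, y⟫ * q (x - m)) + ⟪m, y⟫ := by
      rw [hc]; ring
    rw [e7, e4]
    field_simp
    ring
  rw [Real.le_log_iff_exp_le]
  · linarith
  · have := Real.exp_pos c
    linarith



theorem det_bound {n : ℕ} {ι : Type*} [Fintype ι] (p : ι → ℝ) (hp : ∀ i, 0 ≤ p i)
    (hs : ∑ i, p i = 1) (A : ι → Set (E n)) (hA : ∀ i, IsCompact (A i))
    (h0 : ∀ i, 0 < volume (A i)) (y : E n) (T : E n →L[ℝ] E n)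
    (hT : ∀ v w, ⟪T v, w⟫ = ∑ i, p i * ((tz (A i) y)⁻¹ * ∫ x in A i,
      Real.exp ⟪x, y⟫ * (⟪x - tmean (A i) y, v⟫ * ⟪x - tmean (A i) y, w⟫)))
    (hTp : ∀ v, v ≠ 0 → 0 < ⟪T v, v⟫) :
    Real.exp (2 * ∑ i, p i * Real.log (tz (A i) y) - 2 * ∑ i, p i * ⟪tmean (A i) y, y⟫ - 3 * n)
      ≤ T.det := by
  have hsym : (T : E n →ₗ[ℝ] E n).IsSymmetric := by
    intro v w
    change ⟪T v, w⟫ = ⟪v, T w⟫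
    rw [real_inner_comm (T w) v, hT, hT]
    refine Finset.sum_congr rfl fun i _ => ?_
    congr 2
    refine integral_congr_ae (Filter.Eventually.of_forall fun x => ?_)
    simp only
    ring
  have hn : Module.finrank ℝ (E n) = n := by simp
  set b := hsym.eigenvectorBasis hn with hb
  set l := hsym.eigenvalues hn with hl
  have hTb : ∀ k, ⟪T (b k), b k⟫ = l k := by
    intro k
    have := hsym.apply_eigenvectorBasis hn k
    change T (b k) = l k • b k at this
    rw [this, inner_smul_left]
    simp [real_inner_self_eq_norm_sq]
  have hlp : ∀ k, 0 < l k := by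
    intro k
    rw [← hTb]
    refine hTp _ fun h => ?_
    have := b.norm_eq_one k
    rw [h] at this
    simp at this
  have hdet : T.det = ∏ k, l k := by
    have := hsym.det_eq_prod_eigenvalues hn
    simpa using this
  obtain ⟨gi, gv⟩ := gauss_int b l hlp
  have hg : ∀ i, _ := fun i => gibbs (hA i) (h0 i) y (fun x => ∑ k, ⟪b k, x⟫ ^ 2 / l k) (by fun_prop) gi
  rw [gv] at hg
  set L := Real.log (∏ k, √(2 * π * l k)) with hL
  have hsum : ∑ i, p i * (- (1/2) * ((tz (A i) y)⁻¹ * ∫ x in A i, Real.exp ⟪x, y⟫ *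
      ∑ k, ⟪b k, x - tmean (A i) y⟫ ^ 2 / l k) - ⟪tmean (A i) y, y⟫ + Real.log (tz (A i) y)) ≤ L := by
    calc _ ≤ ∑ i, p i * L := Finset.sum_le_sum fun i _ => mul_le_mul_of_nonneg_left (hg i) (hp i)
      _ = L := by rw [← Finset.sum_mul, hs, one_mul]
  have htr : ∑ i, p i * ((tz (A i) y)⁻¹ * ∫ x in A i, Real.exp ⟪x, y⟫ *
      ∑ k, ⟪b k, x - tmean (A i) y⟫ ^ 2 / l k) = n := by
    have h1 : ∀ i, p i * ((tz (A i) y)⁻¹ * ∫ x in A i, Real.exp ⟪x, y⟫ *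
      ∑ k, ⟪b k, x - tmean (A i) y⟫ ^ 2 / l k) = ∑ k, (l k)⁻¹ * (p i * ((tz (A i) y)⁻¹ * ∫ x in A i,
      Real.exp ⟪x, y⟫ * (⟪x - tmean (A i) y, b k⟫ * ⟪x - tmean (A i) y, b k⟫))) := by
      intro i
      have : ∫ x in A i, Real.exp ⟪x, y⟫ * ∑ k, ⟪b k, x - tmean (A i) y⟫ ^ 2 / l k =
        ∑ k, (l k)⁻¹ * ∫ x in A i,
      Real.exp ⟪x, y⟫ * (⟪x - tmean (A i) y, b k⟫ * ⟪x - tmean (A i) y, b k⟫) := by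
        simp_rw [← integral_const_mul]
        rw [← integral_finsetSum _ fun k _ => intOn (hA i) (by fun_prop)]
        congr 1; ext x
        rw [Finset.mul_sum]
        refine Finset.sum_congr rfl fun k _ => ?_
        rw [real_inner_comm (x - tmean (A i) y) (b k)]; ring
      rw [this, Finset.mul_sum, Finset.mul_sum]
      refine Finset.sum_congr rfl fun k _ => ?_
      ring
    simp_rw [h1]
    rw [Finset.sum_comm]
    simp_rw [← Finset.mul_sum, ← hT, hTb]
    have : ∀ k, (l k)⁻¹ * l k = 1 := fun k => inv_mul_cancel₀ (hlp k).ne'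
    simp [this]
  have hsum2 : - (1/2) * (n : ℝ) - ∑ i, p i * ⟪tmean (A i) y, y⟫ + ∑ i, p i * Real.log (tz (A i) y) ≤ L := by
    rw [← htr]
    refine le_trans (le_of_eq ?_) hsum
    rw [Finset.mul_sum, ← Finset.sum_sub_distrib, ← Finset.sum_add_distrib]
    refine Finset.sum_congr rfl fun i _ => ?_
    ring
  have hL2 : 2 * L = n * Real.log (2 * π) + Real.log (∏ k, l k) := by
    rw [hL, Real.log_prod (fun k _ => by have := hlp k; positivity), Real.log_prod (fun k _ => (hlp k).ne'), Finset.mul_sum]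
    have : ∀ k, 2 * Real.log √(2 * π * l k) = Real.log (2 * π) + Real.log (l k) := by
      intro k
      rw [Real.log_sqrt (by have := hlp k; positivity), Real.log_mul (by positivity) (hlp k).ne']
      ring
    simp_rw [this]
    rw [Finset.sum_add_distrib]
    simp
  have hpi : Real.log (2 * π) ≤ 2 := by
    rw [Real.log_le_iff_le_exp (by positivity)]
    have h1 := Real.pi_lt_d2
    have h2 := Real.exp_one_gt_d9
    have h3 : Real.exp 2 = Real.exp 1 * Real.exp 1 := by rw [← Real.exp_add]; norm_num
    rw [h3]
    nlinarith
  have hpos : 0 < ∏ k, l k := Finset.prod_pos fun k _ => hlp k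
  rw [hdet, ← Real.le_log_iff_exp_le hpos]
  have hn0 : (0 : ℝ) ≤ n := Nat.cast_nonneg n
  nlinarith

theorem main_vol {n : ℕ} {ι : Type*} [Fintype ι] (p : ι → ℝ) (hp : ∀ i, 0 ≤ p i)
    (hs : ∑ i, p i = 1) (A : ι → Set (E n)) (hA : ∀ i, IsCompact (A i))
    (hc : ∀ i, Convex ℝ (A i))
    (h0 : ∀ i, 0 < volume (A i)) (hbar : ∀ i, ∫ x in A i, x = 0) (G D : Set (E n))
    (hD : MeasurableSet D) (hG : ∀ a : ι → E n, (∀ i, a i ∈ A i) → ∑ i, p i • a i ∈ G)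
    (hGD : ∀ g ∈ G, ∀ y ∈ D, ⟪g, y⟫ ≤ 3 * n) :
    ENNReal.ofReal (Real.exp (2 * ∑ i, p i * Real.log (volume (A i)).toReal - 9 * n)) * volume D
      ≤ volume G := by
  choose S hS1 hS2 using fun i y => exists_cov (hA i) (h0 i) y
  set Φ : E n → E n := fun y => ∑ i, p i • tmean (A i) y with hΦ
  set T : E n → E n →L[ℝ] E n := fun y => ∑ i, p i • S i y with hTdef
  have hd : ∀ y, HasFDerivAt Φ (T y) y := fun y =>
    HasFDerivAt.fun_sum fun i _ => (hS1 i y).const_smul (p i)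
  have hT : ∀ y v w, ⟪T y v, w⟫ = ∑ i, p i * ((tz (A i) y)⁻¹ * ∫ x in A i,
      Real.exp ⟪x, y⟫ * (⟪x - tmean (A i) y, v⟫ * ⟪x - tmean (A i) y, w⟫)) := by
    intro y v w
    simp only [hTdef, ContinuousLinearMap.sum_apply, sum_inner]
    refine Finset.sum_congr rfl fun i _ => ?_
    rw [← hS2, ContinuousLinearMap.smul_apply, inner_smul_left]
    simp
  have hTp : ∀ y v, v ≠ 0 → 0 < ⟪T y v, v⟫ := by
    intro y v hv
    rw [hT]
    have hpos : ∀ i, 0 < (tz (A i) y)⁻¹ * ∫ x in A i,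
      Real.exp ⟪x, y⟫ * (⟪x - tmean (A i) y, v⟫ * ⟪x - tmean (A i) y, v⟫) := fun i =>
      mul_pos (inv_pos.2 (tz_pos (hA i) (h0 i) y)) (cov_pos (hA i) (h0 i) _ _ _ hv)
    have hex : ∃ i ∈ Finset.univ, 0 < p i := by
      by_contra! h
      have := Finset.sum_nonpos h
      linarith
    obtain ⟨i, hi, hpi⟩ := hex
    exact Finset.sum_pos' (fun j _ => mul_nonneg (hp j) (hpos j).le) ⟨i, hi, mul_pos hpi (hpos i)⟩
  have hinj : Function.Injective Φ := by
    intro y y' h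
    by_contra hne
    have hv : y' - y ≠ 0 := sub_ne_zero.2 (Ne.symm hne)
    have hg : ∀ t : ℝ, HasDerivAt (fun t : ℝ => ⟪Φ (y + t • (y' - y)), y' - y⟫)
        ⟪T (y + t • (y' - y)) (y' - y), y' - y⟫ t := by
      intro t
      have h1 : HasDerivAt (fun t : ℝ => y + t • (y' - y)) (y' - y) t := by
        simpa using ((hasDerivAt_id t).smul_const (y' - y)).const_add y
      have h2 := (hd (y + t • (y' - y))).comp_hasDerivAt t h1
      have h3 := h2.inner ℝ (hasDerivAt_const t (y' - y))
      simpa using h3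
    have hmono : StrictMono (fun t : ℝ => ⟪Φ (y + t • (y' - y)), y' - y⟫) :=
      strictMono_of_hasDerivAt_pos hg fun t => hTp _ _ hv
    have := hmono (zero_lt_one)
    simp [h] at this
  have hW : ∀ i y, Real.log (volume (A i)).toReal ≤ Real.log (tz (A i) y) := by
    intro i y
    have hfin : volume (A i) ≠ ⊤ := (hA i).measure_lt_top.ne
    refine Real.log_le_log (ENNReal.toReal_pos (h0 i).ne' hfin) ?_
    have e1 : ∫ x in A i, (1 + ⟪x, y⟫) = (volume (A i)).toReal := by
      rw [integral_add (intOn (hA i) (by fun_prop)) (intOn (hA i) (by fun_prop))]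
      have : ∫ x in A i, ⟪x, y⟫ = 0 := by
        have h1 := integral_inner (𝕜 := ℝ) (μ := volume.restrict (A i)) (f := fun x : E n => x) (intOn (hA i) (by fun_prop)) y
        simp_rw [real_inner_comm y] 
        rw [h1, hbar]; simp
      rw [this]
      simp [Measure.real]
    rw [← e1]
    refine integral_mono (intOn (hA i) (by fun_prop)) (intOn (hA i) (by fun_prop)) fun x => ?_
    have := Real.add_one_le_exp ⟪x, y⟫
    simp only
    linarith
  have himg : Φ '' D ⊆ G := by
    rintro _ ⟨y, _, rfl⟩
    exact hG _ fun i => tmean_mem (hA i) (hc i) (h0 i) y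
  calc _ = ∫⁻ y in D, ENNReal.ofReal (Real.exp (2 * ∑ i, p i * Real.log (volume (A i)).toReal - 9 * n)) := by
        rw [setLIntegral_const]
    _ ≤ ∫⁻ y in D, ENNReal.ofReal |(T y).det| := by
        refine setLIntegral_mono' hD fun y hy => ENNReal.ofReal_le_ofReal ?_
        refine le_trans ?_ ((det_bound p hp hs A hA h0 y (T y) (hT y) (hTp y)).trans (le_abs_self _))
        refine Real.exp_le_exp.2 ?_
        have h1 : ∑ i, p i * ⟪tmean (A i) y, y⟫ ≤ 3 * n := by
          have := hGD (Φ y) (himg ⟨y, hy, rfl⟩) y hy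
          simpa [hΦ, sum_inner, inner_smul_left] using this
        have h2 : ∑ i, p i * Real.log (volume (A i)).toReal ≤ ∑ i, p i * Real.log (tz (A i) y) :=
          Finset.sum_le_sum fun i _ => mul_le_mul_of_nonneg_left (hW i y) (hp i)
        linarith
    _ = volume (Φ '' D) := lintegral_abs_det_fderiv_eq_addHaar_image volume hD
        (fun y _ => (hd y).hasFDerivWithinAt) hinj.injOn
    _ ≤ volume G := measure_mono himg



theorem symm_int {n : ℕ} {A : Set (E n)} (hm : MeasurableSet A) (hs : ∀ x ∈ A, -x ∈ A) :
    ∫ x in A, x = 0 := by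
  have hs' : ∀ x, -x ∈ A ↔ x ∈ A := fun x => ⟨fun h => by simpa using hs _ h, hs x⟩
  rw [← integral_indicator hm]
  have h1 := integral_neg_eq_self (A.indicator fun x : E n => x) volume
  have h2 : (fun x : E n => A.indicator (fun x : E n => x) (-x)) = fun x => - A.indicator (fun x : E n => x) x := by
    ext1 x
    by_cases h : x ∈ A
    · rw [Set.indicator_of_mem h, Set.indicator_of_mem ((hs' x).2 h)]
    · rw [Set.indicator_of_notMem h, Set.indicator_of_notMem (fun h' => h ((hs' x).1 h')), neg_zero]
  rw [h2, integral_neg] at h1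
  generalize (∫ x : E n, A.indicator (fun x : E n => x) x) = v at h1 ⊢
  have h3 : (2 : ℝ) • v = 0 := by
    rw [two_smul]
    nth_rewrite 1 [← h1]
    simp
  simpa using h3

/-- Symmetrised section of `2K`. -/
def ahat {n : ℕ} (P : Set (E n)) (z : E n) : Set (E n) :=
  {a | a + (1/2 : ℝ) • z ∈ P ∧ (1/2 : ℝ) • z - a ∈ P}

/-- Its intersection with a ball. -/
def asec {n : ℕ} (P : Set (E n)) (z : E n) : Set (E n) :=
  ahat P z ∩ Metric.closedBall 0 2

theorem ahat_convex {n : ℕ} {P : Set (E n)} (hP : Convex ℝ P) (z : E n) : Convex ℝ (ahat P z) := by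
  intro a ha b hb s t hs ht hst
  have e : (1/2 : ℝ) • z = s • ((1/2 : ℝ) • z) + t • ((1/2 : ℝ) • z) := by
    rw [← add_smul, hst, one_smul]
  constructor
  · have := hP ha.1 hb.1 hs ht hst
    convert this using 1
    nth_rewrite 1 [e]
    simp only [smul_add]; abel
  · have := hP ha.2 hb.2 hs ht hst
    convert this using 1
    nth_rewrite 1 [e]
    simp only [smul_sub]; abel

theorem ahat_closed {n : ℕ} {P : Set (E n)} (hP : IsClosed P) (z : E n) : IsClosed (ahat P z) :=
  (hP.preimage (by fun_prop : Continuous fun a : E n => a + (1/2 : ℝ) • z)).inter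
    (hP.preimage (by fun_prop : Continuous fun a : E n => (1/2 : ℝ) • z - a))

theorem ahat_neg {n : ℕ} {P : Set (E n)} {z a : E n} (h : a ∈ ahat P z) : -a ∈ ahat P z := by
  constructor
  · have := h.2
    rwa [neg_add_eq_sub]
  · have := h.1
    rwa [sub_neg_eq_add, add_comm]

theorem asec_compact {n : ℕ} {P : Set (E n)} (hP : IsClosed P) (z : E n) : IsCompact (asec P z) :=
  (isCompact_closedBall 0 2).inter_left (ahat_closed hP z)

theorem asec_convex {n : ℕ} {P : Set (E n)} (hP : Convex ℝ P) (z : E n) : Convex ℝ (asec P z) :=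
  (ahat_convex hP z).inter (convex_closedBall 0 2)

theorem asec_neg {n : ℕ} {P : Set (E n)} {z a : E n} (h : a ∈ asec P z) : -a ∈ asec P z :=
  ⟨ahat_neg h.1, by simpa using h.2⟩

theorem vol_ahat_le {n : ℕ} {P : Set (E n)} (hP : Convex ℝ P) (s : Finset (E n))
    (hs : ∀ x ∈ P, ∃ c ∈ s, ‖x - (2:ℝ) • c‖ ≤ 2) (z : E n) :
    volume (ahat P z) ≤ s.card * (ENNReal.ofReal (2 ^ n) * volume (asec P z)) := by
  have h1 : ahat P z ⊆ ⋃ c ∈ s, (ahat P z ∩ {a | ‖a + (1/2 : ℝ) • z - (2:ℝ) • c‖ ≤ 2}) := by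
    intro a ha
    obtain ⟨c, hc, h⟩ := hs _ ha.1
    simp only [Set.mem_iUnion]
    exact ⟨c, hc, ha, h⟩
  have h2 : ∀ c, volume (ahat P z ∩ {a | ‖a + (1/2 : ℝ) • z - (2:ℝ) • c‖ ≤ 2}) ≤
      ENNReal.ofReal (2 ^ n) * volume (asec P z) := by
    intro c
    rcases (ahat P z ∩ {a | ‖a + (1/2 : ℝ) • z - (2:ℝ) • c‖ ≤ 2}).eq_empty_or_nonempty with h | ⟨t, ht⟩
    · rw [h]; simp
    · have hsub : (ahat P z ∩ {a | ‖a + (1/2 : ℝ) • z - (2:ℝ) • c‖ ≤ 2}) ⊆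
          (fun a => -t + a) ⁻¹' ((2:ℝ) • asec P z) := by
        intro a ha
        refine Set.mem_smul_set.2 ⟨(1/2 : ℝ) • a + (1/2 : ℝ) • (-t), ⟨?_, ?_⟩, ?_⟩
        · exact ahat_convex hP z ha.1 (ahat_neg ht.1) (by norm_num) (by norm_num) (by norm_num)
        · rw [mem_closedBall_zero_iff]
          have e : (1/2 : ℝ) • a + (1/2 : ℝ) • (-t) = (1/2 : ℝ) • ((a + (1/2 : ℝ) • z - (2:ℝ) • c) - (t + (1/2 : ℝ) • z - (2:ℝ) • c)) := by
            module
          rw [e, norm_smul]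
          have := norm_sub_le (a + (1/2 : ℝ) • z - (2:ℝ) • c) (t + (1/2 : ℝ) • z - (2:ℝ) • c)
          have h3 := ha.2
          have h4 := ht.2
          simp only [Set.mem_ofPred_eq] at h3 h4
          rw [Real.norm_eq_abs, abs_of_pos (by norm_num : (0:ℝ) < 1/2)]
          linarith
        · module
      refine (measure_mono hsub).trans ?_
      rw [measure_preimage_add, Measure.addHaar_smul]
      simp
  calc volume (ahat P z) ≤ _ := measure_mono h1
    _ ≤ _ := measure_biUnion_finset_le _ _
    _ ≤ ∑ c ∈ s, ENNReal.ofReal (2 ^ n) * volume (asec P z) := Finset.sum_le_sum fun c _ => h2 c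
    _ = _ := by rw [Finset.sum_const, nsmul_eq_mul]

theorem vol_pairs_le {n : ℕ} {K P Q : Set (E n)} (hK : MeasurableSet K) (hQ : MeasurableSet Q)
    (hP : K + K ⊆ P) (z₀ : E n) (hz : ∀ z ∈ Q, (1/2 : ℝ) • (z₀ - z) ∈ K) :
    volume {q : E n × E n | q.1 ∈ K ∧ q.2 ∈ K ∧ q.1 + q.2 ∈ Q} ≤ volume (ahat P z₀) * volume Q := by
  have mp := measurePreserving_prod_add (volume : Measure (E n)) (volume : Measure (E n))
  have hset : MeasurableSet {q : E n × E n | q.1 ∈ K ∧ q.2 - q.1 ∈ K ∧ q.2 ∈ Q} := by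
    refine MeasurableSet.inter (measurable_fst hK) (MeasurableSet.inter ?_ (measurable_snd hQ))
    exact (measurable_snd.sub measurable_fst) hK
  have e : {q : E n × E n | q.1 ∈ K ∧ q.2 ∈ K ∧ q.1 + q.2 ∈ Q} =
      (fun q : E n × E n => (q.1, q.1 + q.2)) ⁻¹' {q : E n × E n | q.1 ∈ K ∧ q.2 - q.1 ∈ K ∧ q.2 ∈ Q} := by
    ext q; simp
  rw [e, Measure.volume_eq_prod, mp.measure_preimage hset.nullMeasurableSet, Measure.prod_apply_symm hset]
  calc _ ≤ ∫⁻ z, Q.indicator (fun _ => volume (ahat P z₀)) z := by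
        refine lintegral_mono fun z => ?_
        by_cases h : z ∈ Q
        · rw [Set.indicator_of_mem h]
          have : (fun x => (x, z)) ⁻¹' {q : E n × E n | q.1 ∈ K ∧ q.2 - q.1 ∈ K ∧ q.2 ∈ Q} ⊆
            (fun x => -((1/2 : ℝ) • z) + x) ⁻¹' (ahat P z₀) := by
            rintro x ⟨h1, h2, h3⟩
            simp only at h1 h2 h3
            have h4 := hz z h
            constructor
            · have := hP (Set.add_mem_add h1 h4)
              convert this using 1
              module
            · have := hP (Set.add_mem_add h2 h4)
              convert this using 1
              module
          refine (measure_mono this).trans ?_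
          rw [measure_preimage_add]
        · rw [Set.indicator_of_notMem h]
          have : (fun x => (x, z)) ⁻¹' {q : E n × E n | q.1 ∈ K ∧ q.2 - q.1 ∈ K ∧ q.2 ∈ Q} = ∅ := by
            ext x; simp [h]
          rw [this]; simp
    _ = _ := by rw [lintegral_indicator hQ, setLIntegral_const]

theorem zero_mem_interior {n : ℕ} {K : Set (E n)} (hc : Convex ℝ K) (hK : IsCompact K)
    (hi : (interior K).Nonempty) (hb : ∫ x in K, x = 0) : (0 : E n) ∈ interior K := by
  obtain ⟨x₀, hx⟩ := hi
  obtain ⟨r, hr, hsub⟩ := Metric.isOpen_iff.1 isOpen_interior x₀ hx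
  have hsub' : Metric.closedBall x₀ (r/2) ⊆ interior K :=
    (Metric.closedBall_subset_ball (by linarith)).trans hsub
  have hpos : volume (Metric.closedBall x₀ (r/2)) ≠ 0 :=
    (Metric.measure_closedBall_pos volume x₀ (by linarith)).ne'
  have : IsFiniteMeasure (volume.restrict K) := ⟨by simpa using hK.measure_lt_top⟩
  have hr1 : (volume.restrict K).restrict (Metric.closedBall x₀ (r/2)) = volume.restrict (Metric.closedBall x₀ (r/2)) := by
    rw [Measure.restrict_restrict Metric.isClosed_closedBall.measurableSet,
      Set.inter_eq_left.2 (hsub'.trans interior_subset)]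
  have h := hc.average_mem_interior_of_set (μ := volume.restrict K) (f := fun x : E n => x)
    (t := Metric.closedBall x₀ (r/2)) ?_ (ae_restrict_mem hK.measurableSet) (intOn hK (by fun_prop)) ?_
  · rwa [average_eq, hb, smul_zero] at h
  · rw [Measure.restrict_apply Metric.isClosed_closedBall.measurableSet,
      Set.inter_eq_left.2 (hsub'.trans interior_subset)]
    exact hpos
  · rw [hr1]
    apply hsub'
    exact (convex_closedBall x₀ (r/2)).set_average_mem Metric.isClosed_closedBall hpos
      (isCompact_closedBall _ _).measure_lt_top.ne (ae_restrict_mem Metric.isClosed_closedBall.measurableSet)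
      (intOn (isCompact_closedBall _ _) (by fun_prop))



theorem exists_family {n : ℕ} {K : Set (E n)} (hc : Convex ℝ K) (hK : IsCompact K)
    (hi : (interior K).Nonempty) (hb : ∫ x in K, x = 0) (s : Finset (E n))
    (hs : ∀ x ∈ K, ∃ c ∈ s, ‖x - c‖ ≤ 1) :
    ∃ (m : ℕ) (p : Fin m → ℝ) (z : Fin m → E n), (∀ i, 0 ≤ p i) ∧ ∑ i, p i = 1 ∧
      ∑ i, p i • z i = 0 ∧ (∀ i, 0 < volume (asec ((2:ℝ) • K) (z i))) ∧
      Real.log ((volume K).toReal / (4 ^ n * s.card)) ≤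
        ∑ i, p i * Real.log (volume (asec ((2:ℝ) • K) (z i))).toReal := by
  set P : Set (E n) := (2:ℝ) • K with hPdef
  have hP : Convex ℝ P := hc.smul 2
  have h0 := zero_mem_interior hc hK hi hb
  obtain ⟨r, hr, hrK⟩ : ∃ r > 0, Metric.closedBall (0 : E n) r ⊆ K := by
    obtain ⟨r, hr, h⟩ := Metric.isOpen_iff.1 isOpen_interior _ h0
    exact ⟨r/2, by linarith, (Metric.closedBall_subset_ball (by linarith)).trans (h.trans interior_subset)⟩
  have hKK : K + K = P := by
    have := hc.add_smul (p := 1) (q := 1) zero_le_one zero_le_one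
    rw [one_smul] at this
    rw [← this, hPdef]; norm_num
  have hPc : IsCompact P := hKK ▸ hK.add hK
  have hsP : ∀ x ∈ P, ∃ c ∈ s, ‖x - (2:ℝ) • c‖ ≤ 2 := by
    intro x hx
    obtain ⟨k, hk, rfl⟩ := Set.mem_smul_set.1 hx
    obtain ⟨c, hcs, h⟩ := hs k hk
    refine ⟨c, hcs, ?_⟩
    rw [← smul_sub, norm_smul]
    norm_num
    linarith
  have hKpos : 0 < volume K := (isOpen_interior.measure_pos volume hi).trans_le (measure_mono interior_subset)
  have hKfin : volume K ≠ ⊤ := hK.measure_lt_top.ne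
  set vK := (volume K).toReal with hvK
  have hvKpos : 0 < vK := ENNReal.toReal_pos hKpos.ne' hKfin
  obtain ⟨t, -, htf, htc⟩ := hPc.finite_cover_balls hr
  obtain ⟨m, w, hw⟩ : ∃ (m : ℕ) (w : Fin m → E n), P ⊆ ⋃ j, Metric.ball (w j) r := by
    have : Finite t := htf
    obtain ⟨m, ⟨e⟩⟩ := Finite.exists_equiv_fin t
    refine ⟨m, fun j => (e.symm j : E n), htc.trans ?_⟩
    intro x hx
    simp only [Set.mem_iUnion] at hx ⊢
    obtain ⟨y, hy, h⟩ := hx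
    exact ⟨e ⟨y, hy⟩, by simpa using h⟩
  set Q : Fin m → Set (E n) := fun j => P ∩ (Metric.ball (w j) r \ ⋃ i, ⋃ (_ : i < j), Metric.ball (w i) r) with hQ
  have hQm : ∀ j, MeasurableSet (Q j) := fun j =>
    hPc.measurableSet.inter (Metric.isOpen_ball.measurableSet.diff
      (MeasurableSet.iUnion fun i => MeasurableSet.iUnion fun _ => Metric.isOpen_ball.measurableSet))
  have hQd' : ∀ i j, i < j → Disjoint (Q i) (Q j) := by
    intro i j hij
    rw [Set.disjoint_left]
    intro x hx hx'
    apply hx'.2.2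
    simp only [Set.mem_iUnion]
    exact ⟨i, hij, hx.2.1⟩
  have hQd : Pairwise (Function.onFun Disjoint Q) := by
    intro i j hij
    rcases lt_or_gt_of_ne hij with h | h
    · exact hQd' i j h
    · exact (hQd' j i h).symm
  have hQu : ∀ x ∈ P, ∃ j, x ∈ Q j := by
    intro x hx
    classical
    have hne : (Finset.univ.filter fun j => x ∈ Metric.ball (w j) r).Nonempty := by
      obtain ⟨j, hj⟩ := Set.mem_iUnion.1 (hw hx)
      exact ⟨j, by simpa using hj⟩
    refine ⟨Finset.min' _ hne, hx, ?_, ?_⟩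
    · have := Finset.min'_mem _ hne
      simpa using this
    · simp only [Set.mem_iUnion, not_exists]
      intro i hi hxi
      have := Finset.min'_le _ i (by simpa using hxi : i ∈ Finset.univ.filter fun j => x ∈ Metric.ball (w j) r)
      exact absurd hi (not_lt.2 this)
  set C : Fin m → Set (E n × E n) := fun j => {q | q.1 ∈ K ∧ q.2 ∈ K ∧ q.1 + q.2 ∈ Q j} with hC
  have hCm : ∀ j, MeasurableSet (C j) := fun j =>
    MeasurableSet.inter (measurable_fst hK.measurableSet) (MeasurableSet.inter
      (measurable_snd hK.measurableSet) ((measurable_fst.add measurable_snd) (hQm j)))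
  have hCd : Pairwise (Function.onFun Disjoint C) := by
    intro i j hij
    rw [Function.onFun, Set.disjoint_left]
    intro q h1 h2
    exact Set.disjoint_left.1 (hQd hij) h1.2.2 h2.2.2
  have hCu : ⋃ j, C j = K ×ˢ K := by
    ext q
    simp only [Set.mem_iUnion, Set.mem_prod]
    constructor
    · rintro ⟨j, h⟩; exact ⟨h.1, h.2.1⟩
    · rintro ⟨h1, h2⟩
      obtain ⟨j, hj⟩ := hQu (q.1 + q.2) (hKK ▸ Set.add_mem_add h1 h2)
      exact ⟨j, h1, h2, hj⟩
  have hKKc : IsCompact (K ×ˢ K) := hK.prod hK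
  have hCsub : ∀ j, C j ⊆ K ×ˢ K := fun j q h => ⟨h.1, h.2.1⟩
  have hCfin : ∀ j, volume (C j) ≠ ⊤ := fun j => ((measure_mono (hCsub j)).trans_lt hKKc.measure_lt_top).ne
  have hKKi : IntegrableOn (fun q : E n × E n => q.1 + q.2) (K ×ˢ K) :=
    (by fun_prop : Continuous fun q : E n × E n => q.1 + q.2).continuousOn.integrableOn_compact hKKc
  set p : Fin m → ℝ := fun j => (volume (C j)).toReal / vK ^ 2 with hpdef
  set z : Fin m → E n := fun j => ⨍ q in C j, (q.1 + q.2) with hzdef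
  have hp0 : ∀ j, 0 ≤ p j := fun j => by positivity
  have hvol : volume (K ×ˢ K) = volume K * volume K := by
    rw [Measure.volume_eq_prod, Measure.prod_prod]
  have hpsum : ∑ j, p j = 1 := by
    rw [hpdef, ← Finset.sum_div, ← ENNReal.toReal_sum fun j _ => hCfin j]
    have : ∑ j, volume (C j) = volume K * volume K := by
      rw [← hvol, ← hCu, measure_iUnion hCd hCm, tsum_fintype]
    rw [this, ENNReal.toReal_mul, div_eq_one_iff_eq (by positivity)]
    ring
  have hpz : ∑ j, p j • z j = 0 := by
    have h1 : ∀ j, p j • z j = (vK ^ 2)⁻¹ • ∫ q in C j, (q.1 + q.2) := by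
      intro j
      rw [← measure_smul_setAverage (fun q : E n × E n => q.1 + q.2) (hCfin j), smul_smul, Measure.real,
        ← div_eq_inv_mul]
    simp_rw [h1]
    rw [← Finset.smul_sum, ← integral_iUnion_fintype hCm hCd fun j => hKKi.mono_set (hCsub j), hCu,
      Measure.volume_eq_prod, ← Measure.prod_restrict]
    have i1 : Integrable (fun x : E n => x) (volume.restrict K) := intOn hK (by fun_prop)
    have : IsFiniteMeasure (volume.restrict K) := ⟨by simpa using hK.measure_lt_top⟩
    rw [integral_add (i1.comp_fst _) (i1.comp_snd _), integral_fun_fst (fun x : E n => x), integral_fun_snd (fun x : E n => x), hb]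
    simp
  have hzz : ∀ j, p j ≠ 0 → ∀ x ∈ Q j, (1/2 : ℝ) • (z j - x) ∈ K := by
    intro j hj x hx
    have hC0 : volume (C j) ≠ 0 := by
      intro h
      apply hj
      simp [hpdef, h]
    have hzb : z j ∈ Metric.closedBall (w j) r := by
      refine (convex_closedBall (w j) r).set_average_mem Metric.isClosed_closedBall hC0 (hCfin j) ?_
        (hKKi.mono_set (hCsub j))
      filter_upwards [ae_restrict_mem (hCm j)] with q hq
      exact Metric.ball_subset_closedBall hq.2.2.2.1
    apply hrK
    rw [mem_closedBall_zero_iff, norm_smul]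
    have h1 : dist (z j) x ≤ dist (z j) (w j) + dist x (w j) := dist_triangle_right _ _ _
    have h2 : dist x (w j) < r := hx.2.1
    have h3 : dist (z j) (w j) ≤ r := hzb
    rw [← dist_eq_norm, Real.norm_eq_abs, abs_of_pos (by norm_num : (0:ℝ) < 1/2)]
    linarith
  have hkey : ∀ j, p j ≠ 0 → volume (C j) ≤ (s.card * (ENNReal.ofReal (2 ^ n) * volume (asec P (z j)))) * volume (Q j) := by
    intro j hj
    refine (vol_pairs_le hK.measurableSet (hQm j) hKK.le (z j) (hzz j hj)).trans ?_
    gcongr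
    exact vol_ahat_le hP s hsP (z j)
  have hpos : ∀ j, 0 < volume (asec P (z j)) := by
    intro j
    by_cases hj : p j = 0
    · have hC0 : volume (C j) = 0 := by
        have : (volume (C j)).toReal = 0 := by
          have h := hj
          simp only [hpdef, div_eq_zero_iff] at h
          rcases h with h | h
          · exact h
          · exact absurd h (by positivity)
        rcases (ENNReal.toReal_eq_zero_iff _).1 this with h | h
        · exact h
        · exact absurd h (hCfin j)
      have hz0 : z j = 0 := by
        simp only [hzdef]
        rw [Measure.restrict_eq_zero.2 hC0, average_zero_measure]
      have hKP : K ⊆ P := by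
        intro x hx
        rw [← hKK]
        have : (0 : E n) ∈ K := interior_subset h0
        exact ⟨x, hx, 0, this, by simp⟩
      refine (Metric.measure_closedBall_pos volume (0 : E n) (r := min r 2) (by positivity)).trans_le (measure_mono ?_)
      intro x hx
      rw [mem_closedBall_zero_iff] at hx
      have hx1 := hx.trans (min_le_left _ _)
      have hx2 := hx.trans (min_le_right _ _)
      refine ⟨⟨?_, ?_⟩, ?_⟩
      · apply hKP; apply hrK; simpa [hz0] using hx1
      · apply hKP; apply hrK; simpa [hz0] using hx1
      · simpa using hx2
    · have h1 := hkey j hj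
      rw [pos_iff_ne_zero]
      intro h
      rw [h] at h1
      simp only [mul_zero, zero_mul, nonpos_iff_eq_zero] at h1
      apply hj
      simp [hpdef, h1]
  refine ⟨m, p, z, hp0, hpsum, hpz, hpos, ?_⟩
  have hNpos : 0 < (s.card : ℝ) := by
    obtain ⟨c, hcs, -⟩ := hs 0 (interior_subset h0)
    exact_mod_cast Finset.card_pos.2 ⟨c, hcs⟩
  set κ := vK / (4 ^ n * s.card) with hκ
  have hκpos : 0 < κ := by positivity
  have hQfin : ∀ j, volume (Q j) ≠ ⊤ := fun j =>
    ((measure_mono Set.inter_subset_left).trans_lt hPc.measure_lt_top).ne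
  set q : Fin m → ℝ := fun j => (volume (Q j)).toReal / (2 ^ n * vK) with hq
  have hqsum : ∑ j, q j ≤ 1 := by
    rw [hq, ← Finset.sum_div, ← ENNReal.toReal_sum fun j _ => hQfin j, div_le_one (by positivity)]
    have : ∑ j, volume (Q j) ≤ volume P := by
      rw [← tsum_fintype (L := .unconditional _), ← measure_iUnion hQd hQm]
      exact measure_mono (Set.iUnion_subset fun j => Set.inter_subset_left)
    refine (ENNReal.toReal_mono hPc.measure_lt_top.ne this).trans (le_of_eq ?_)
    rw [hPdef, Measure.addHaar_smul, ENNReal.toReal_mul]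
    simp [hvK]
  have hterm : ∀ j, p j * Real.log κ + (p j - q j) ≤ p j * Real.log (volume (asec P (z j))).toReal := by
    intro j
    have hq0 : 0 ≤ q j := by positivity
    by_cases hj : p j = 0
    · rw [hj, zero_mul, zero_mul]; linarith
    have hpj : 0 < p j := lt_of_le_of_ne (hp0 j) (Ne.symm hj)
    have hafin : volume (asec P (z j)) ≠ ⊤ := (asec_compact hPc.isClosed (z j)).measure_lt_top.ne
    have hapos := ENNReal.toReal_pos (hpos j).ne' hafin
    set α := (volume (asec P (z j))).toReal with hα
    have h1 : (volume (C j)).toReal ≤ (s.card * (2 ^ n * α)) * (volume (Q j)).toReal := by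
      have := ENNReal.toReal_mono ?_ (hkey j hj)
      · rw [ENNReal.toReal_mul, ENNReal.toReal_mul, ENNReal.toReal_mul,
          ENNReal.toReal_ofReal (by positivity), ENNReal.toReal_natCast] at this
        exact this
      · finiteness [hQfin j]
    have h2 : κ * p j ≤ α * q j := by
      have e1 : (volume (C j)).toReal = p j * vK ^ 2 := by
        simp only [hpdef]; field_simp
      have e2 : (volume (Q j)).toReal = q j * (2 ^ n * vK) := by
        simp only [hq]; field_simp
      rw [e1, e2] at h1
      rw [hκ, div_mul_eq_mul_div, div_le_iff₀ (mul_pos (pow_pos (by norm_num) n) hNpos)]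
      have e3 : (4:ℝ) ^ n = 2 ^ n * 2 ^ n := by rw [← mul_pow]; norm_num
      rw [e3]
      have : vK * (vK * p j) ≤ vK * (α * q j * (2 ^ n * 2 ^ n * s.card)) := by
        calc _ = p j * vK ^ 2 := by ring
          _ ≤ _ := h1
          _ = _ := by ring
      exact le_of_mul_le_mul_left this hvKpos
    have hqj : 0 < q j := by
      rcases hq0.lt_or_eq with h | h
      · exact h
      · rw [← h] at h2
        have := mul_pos hκpos hpj
        linarith
    have h3 : Real.log κ + Real.log (p j) ≤ Real.log α + Real.log (q j) := by
      rw [← Real.log_mul hκpos.ne' hj, ← Real.log_mul hapos.ne' hqj.ne']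
      exact Real.log_le_log (by positivity) h2
    have h4 : Real.log (q j / p j) ≤ q j / p j - 1 := Real.log_le_sub_one_of_pos (by positivity)
    rw [Real.log_div hqj.ne' hj] at h4
    have h5 : p j * (Real.log κ + 1 - q j / p j) ≤ p j * Real.log α := by
      apply mul_le_mul_of_nonneg_left _ (hp0 j)
      linarith
    have h6 : p j * (Real.log κ + 1 - q j / p j) = p j * Real.log κ + (p j - q j) := by
      field_simp
      ring
    linarith
  have := Finset.sum_le_sum fun j (_ : j ∈ Finset.univ) => hterm j
  rw [Finset.sum_add_distrib, ← Finset.sum_mul, hpsum, Finset.sum_sub_distrib, hpsum] at this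
  linarith



theorem vol_ball_ge {n : ℕ} (hn : 0 < n) :
    1 ≤ (n : ℝ) ^ n * (volume (Metric.closedBall (0 : E n) 1)).toReal ^ 2 := by
  have hn' : (0:ℝ) < n := by exact_mod_cast hn
  set c : ℝ := 1 / √n with hc
  have hcpos : 0 < c := by positivity
  have hsub : (WithLp.ofLp : E n → (Fin n → ℝ)) ⁻¹' (Set.Icc (fun _ => -c) (fun _ => c)) ⊆ Metric.closedBall (0 : E n) 1 := by
    intro x hx
    rw [mem_closedBall_zero_iff, EuclideanSpace.norm_eq, Real.sqrt_le_one]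
    have h1 : ∀ i, ‖x i‖ ^ 2 ≤ 1 / n := by
      intro i
      have h2 : |x i| ≤ c := abs_le.2 ⟨hx.1 i, hx.2 i⟩
      calc ‖x i‖ ^ 2 = |x i| ^ 2 := by rw [Real.norm_eq_abs]
        _ ≤ c ^ 2 := by gcongr
        _ = 1 / n := by rw [hc, div_pow, one_pow, Real.sq_sqrt hn'.le]
    calc _ ≤ ∑ i : Fin n, (1:ℝ) / n := Finset.sum_le_sum fun i _ => h1 i
      _ = 1 := by simp [hn'.ne']
  have hv : volume ((WithLp.ofLp : E n → (Fin n → ℝ)) ⁻¹' (Set.Icc (fun _ => -c) (fun _ => c))) = ENNReal.ofReal ((2 * c) ^ n) := by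
    rw [(PiLp.volume_preserving_ofLp (Fin n)).measure_preimage measurableSet_Icc.nullMeasurableSet,
      Real.volume_Icc_pi]
    simp only [sub_neg_eq_add, Finset.prod_const, Finset.card_univ, Fintype.card_fin]
    rw [← ENNReal.ofReal_pow (by positivity)]
    congr 2; ring
  have h1 : (2 * c) ^ n ≤ (volume (Metric.closedBall (0 : E n) 1)).toReal := by
    rw [← ENNReal.ofReal_le_iff_le_toReal (isCompact_closedBall _ _).measure_lt_top.ne, ← hv]
    exact measure_mono hsub
  have h2 : (1:ℝ) ≤ (n : ℝ) ^ n * ((2 * c) ^ n) ^ 2 := by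
    have : (n : ℝ) ^ n * ((2 * c) ^ n) ^ 2 = (n * (2 * c) ^ 2) ^ n := by
      rw [mul_pow (n:ℝ) ((2 * c) ^ 2) n, ← pow_mul (2 * c) n 2, ← pow_mul (2 * c) 2 n, mul_comm n 2]
    rw [this]
    apply one_le_pow₀
    rw [mul_pow, hc, div_pow, Real.sq_sqrt hn'.le]
    field_simp
    norm_num
  refine h2.trans ?_
  gcongr

/-- Maximal separated sets. -/
theorem exists_net {n : ℕ} (D : Set (E n)) (B : ℝ)
    (hB : ∀ s : Finset (E n), (∀ x ∈ s, x ∈ D) → (∀ x ∈ s, ∀ y ∈ s, x ≠ y → 1 < dist x y) →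
      (s.card : ℝ) ≤ B) :
    ∃ s : Finset (E n), (∀ x ∈ D, ∃ c ∈ s, dist x c ≤ 1) ∧ (s.card : ℝ) ≤ B := by
  classical
  set good : Set (Finset (E n)) := {s | (∀ x ∈ s, x ∈ D) ∧ (∀ x ∈ s, ∀ y ∈ s, x ≠ y → 1 < dist x y)} with hgood
  have hbdd : BddAbove (Finset.card '' good) := by
    refine ⟨⌊B⌋₊, ?_⟩
    rintro _ ⟨s, hs, rfl⟩
    exact Nat.le_floor (hB s hs.1 hs.2)
  have hne : (Finset.card '' good).Nonempty := ⟨0, ∅, by simp [hgood], rfl⟩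
  obtain ⟨s, hs, hcard⟩ := Nat.sSup_mem hne hbdd
  refine ⟨s, ?_, hB s hs.1 hs.2⟩
  intro x hx
  by_contra! h
  have hxs : x ∉ s := by
    intro hxs
    have := h x hxs
    simp at this
    linarith
  have hg : insert x s ∈ good := by
    constructor
    · intro a ha
      rcases Finset.mem_insert.1 ha with rfl | ha
      · exact hx
      · exact hs.1 a ha
    · intro a ha b hb hab
      rcases Finset.mem_insert.1 ha with ha | ha <;> rcases Finset.mem_insert.1 hb with hb | hb
      · exact absurd (ha.trans hb.symm) hab
      · rw [ha]; exact h b hb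
      · rw [hb, dist_comm]; exact h a ha
      · exact hs.2 a ha b hb hab
  have := le_csSup hbdd ⟨_, hg, rfl⟩
  rw [Finset.card_insert_of_notMem hxs, ← hcard] at this
  omega

theorem vol_D {n : ℕ} {K : Set (E n)} (hc : Convex ℝ K) (hK : IsCompact K)
    (hi : (interior K).Nonempty) (hb : ∫ x in K, x = 0) (s : Finset (E n))
    (hs : ∀ x ∈ K, ∃ c ∈ s, ‖x - c‖ ≤ 1) :
    volume {y : E n | ∀ g ∈ asec ((2:ℝ) • K) 0, ⟪g, y⟫ ≤ 3 * n} ≠ ⊤ ∧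
    (volume {y : E n | ∀ g ∈ asec ((2:ℝ) • K) 0, ⟪g, y⟫ ≤ 3 * n}).toReal * (volume K).toReal ≤
      Real.exp (9 * n) * (4 ^ n * s.card) := by
  obtain ⟨m, p, z, hp0, hpsum, hpz, hpos, hW⟩ := exists_family hc hK hi hb s hs
  set P : Set (E n) := (2:ℝ) • K with hPdef
  have hP : Convex ℝ P := hc.smul 2
  have hPc : IsCompact P := hK.smul 2
  have h0 := zero_mem_interior hc hK hi hb
  set G := asec P 0 with hG
  set D := {y : E n | ∀ g ∈ G, ⟪g, y⟫ ≤ 3 * n} with hD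
  have hDm : MeasurableSet D := by
    have : D = ⋂ g ∈ G, {y : E n | ⟪g, y⟫ ≤ 3 * n} := by
      ext y; simp [hD]
    rw [this]
    refine IsClosed.measurableSet (isClosed_biInter fun g _ => ?_)
    exact isClosed_le (by fun_prop) (by fun_prop)
  have hsymm : ∀ z, ∫ x in asec P z, x = 0 := fun z =>
    symm_int (asec_compact hPc.isClosed z).measurableSet fun x hx => asec_neg hx
  have b2 := main_vol p hp0 hpsum (fun i => asec P (z i)) (fun i => asec_compact hPc.isClosed _)
    (fun i => asec_convex hP _) hpos (fun i => hsymm _) G D hDm ?_ (fun g hg y hy => hy g hg)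
  · have hGpos : 0 < volume G := by
      have hKP : K ⊆ P := by
        intro x hx
        refine Set.mem_smul_set.2 ⟨(1/2:ℝ) • x, ?_, by module⟩
        have := hc hx (interior_subset h0) (a := 1/2) (b := 1/2) (by norm_num) (by norm_num) (by norm_num)
        simpa using this
      obtain ⟨r, hr, h⟩ := Metric.isOpen_iff.1 isOpen_interior _ h0
      refine (Metric.measure_ball_pos volume (0 : E n) (r := min r 2) (by positivity)).trans_le (measure_mono ?_)
      intro x hx
      rw [mem_ball_zero_iff, lt_min_iff] at hx
      refine ⟨⟨?_, ?_⟩, ?_⟩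
      · apply hKP; apply interior_subset; apply h; simpa using hx.1
      · apply hKP; apply interior_subset; apply h; simpa using hx.1
      · simpa using hx.2.le
    have b1 := main_vol (ι := Unit) (fun _ => 1) (fun _ => zero_le_one) (by simp) (fun _ => G)
      (fun i => asec_compact hPc.isClosed _)
      (fun i => asec_convex hP _) (fun _ => hGpos) (fun i => hsymm _) G D hDm (fun a ha => by simpa using ha ()) (fun g hg y hy => hy g hg)
    have hGfin : volume G ≠ ⊤ := (asec_compact hPc.isClosed 0).measure_lt_top.ne
    set γ := (volume G).toReal with hγ
    have hγpos : 0 < γ := ENNReal.toReal_pos hGpos.ne' hGfin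
    have hDfin : volume D ≠ ⊤ := by
      intro h
      rw [h, ENNReal.mul_top (by simp [Real.exp_pos])] at b1
      exact hGfin (top_le_iff.1 b1)
    refine ⟨hDfin, ?_⟩
    set δ := (volume D).toReal with hδ
    have c1 := ENNReal.toReal_mono hGfin b1
    have c2 := ENNReal.toReal_mono hGfin b2
    rw [ENNReal.toReal_mul, ENNReal.toReal_ofReal (Real.exp_pos _).le] at c1 c2
    simp only [Finset.univ_unique, Finset.sum_const, Finset.card_singleton, one_smul, one_mul] at c1
    have hKpos : 0 < volume K := (isOpen_interior.measure_pos volume hi).trans_le (measure_mono interior_subset)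
    have hvKpos : 0 < (volume K).toReal := ENNReal.toReal_pos hKpos.ne' hK.measure_lt_top.ne
    set vK := (volume K).toReal with hvK
    have hNpos : 0 < (s.card : ℝ) := by
      obtain ⟨c, hcs, -⟩ := hs 0 (interior_subset h0)
      exact_mod_cast Finset.card_pos.2 ⟨c, hcs⟩
    set M : ℝ := 4 ^ n * s.card with hM
    have hMpos : 0 < M := mul_pos (by positivity) hNpos
    set e := Real.exp (9 * n) with he
    have hepos : 0 < e := Real.exp_pos _
    have hδ0 : 0 ≤ δ := ENNReal.toReal_nonneg
    have d1 : γ * δ ≤ e := by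
      have : Real.exp (2 * Real.log γ - 9 * n) = γ ^ 2 / e := by
        rw [Real.exp_sub, two_mul, Real.exp_add, Real.exp_log hγpos, sq]
      rw [this, div_mul_eq_mul_div, div_le_iff₀ hepos] at c1
      have : γ * (γ * δ) ≤ γ * e := by nlinarith
      exact le_of_mul_le_mul_left this hγpos
    have d2 : (vK / M) ^ 2 * δ ≤ γ * e := by
      have hq : 0 < vK / M := by positivity
      have : (vK / M) ^ 2 / e ≤ Real.exp (2 * ∑ i, p i * Real.log (volume (asec P (z i))).toReal - 9 * n) := by
        have : (vK / M) ^ 2 / e = Real.exp (2 * Real.log (vK / M) - 9 * n) := by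
          rw [Real.exp_sub, two_mul, Real.exp_add, Real.exp_log hq, sq]
        rw [this, Real.exp_le_exp]
        linarith
      have h3 := (mul_le_mul_of_nonneg_right this hδ0).trans c2
      rwa [div_mul_eq_mul_div, div_le_iff₀ hepos] at h3
    have d3 : (vK / M * δ) ^ 2 ≤ e ^ 2 := by
      calc (vK / M * δ) ^ 2 = ((vK / M) ^ 2 * δ) * δ := by ring
        _ ≤ (γ * e) * δ := by gcongr
        _ = (γ * δ) * e := by ring
        _ ≤ e * e := by gcongr
        _ = e ^ 2 := by ring
    have d4 := (pow_le_pow_iff_left₀ (by positivity) hepos.le two_ne_zero).1 d3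
    rw [div_mul_eq_mul_div, div_le_iff₀ hMpos] at d4
    linarith
  · intro a ha
    refine ⟨⟨?_, ?_⟩, ?_⟩
    · have h1 := hP.sum_mem (fun i _ => hp0 i) hpsum (fun i (_ : i ∈ Finset.univ) => (ha i).1.1)
      simp only [smul_add, Finset.sum_add_distrib] at h1
      have h2 : ∑ i, p i • (1/2:ℝ) • z i = 0 := by
        simp_rw [smul_comm _ (1/2:ℝ)]
        rw [← Finset.smul_sum, hpz, smul_zero]
      rw [h2] at h1
      simpa using h1
    · have h1 := hP.sum_mem (fun i _ => hp0 i) hpsum (fun i (_ : i ∈ Finset.univ) => (ha i).1.2)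
      simp only [smul_sub, Finset.sum_sub_distrib] at h1
      have h2 : ∑ i, p i • (1/2:ℝ) • z i = 0 := by
        simp_rw [smul_comm _ (1/2:ℝ)]
        rw [← Finset.smul_sum, hpz, smul_zero]
      rw [h2] at h1
      simpa using h1
    · exact (convex_closedBall (0 : E n) 2).sum_mem (fun i _ => hp0 i) hpsum (fun i _ => (ha i).2)

theorem card_bound {n : ℕ} (hn : 0 < n) {K : Set (E n)} (hc : Convex ℝ K) (hK : IsCompact K)
    (hi : (interior K).Nonempty) (hb : ∫ x in K, x = 0) (s : Finset (E n))
    (hs : ∀ x ∈ K, ∃ c ∈ s, ‖x - c‖ ≤ 1) (a : ℝ) (ha : 0 < a)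
    (hva : a ^ n * (volume (Metric.closedBall (0 : E n) 1)).toReal ≤ (volume K).toReal)
    (t : Finset (E n)) (ht : ∀ y ∈ t, ∀ x ∈ K, ⟪x, y⟫ ≤ 1)
    (hsep : ∀ x ∈ t, ∀ y ∈ t, x ≠ y → 1 < dist x y) :
    (t.card : ℝ) ≤ (8 * Real.exp 9 / a) ^ n * s.card := by
  obtain ⟨hDfin, hD⟩ := vol_D hc hK hi hb s hs
  set D := {y : E n | ∀ g ∈ asec ((2:ℝ) • K) 0, ⟪g, y⟫ ≤ 3 * n} with hDdef
  have hn' : (0:ℝ) < n := by exact_mod_cast hn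
  set β := (volume (Metric.closedBall (0 : E n) 1)).toReal with hβ
  have hβpos : 0 < β := ENNReal.toReal_pos (Metric.measure_closedBall_pos volume _ one_pos).ne'
    (isCompact_closedBall _ _).measure_lt_top.ne
  have hballvol : ∀ y : E n, (volume (Metric.closedBall ((n:ℝ) • y) (n / 2))).toReal = (n/2) ^ n * β := by
    intro y
    rw [Measure.addHaar_closedBall' volume _ (by positivity), ENNReal.toReal_mul, ENNReal.toReal_ofReal (by positivity)]
    simp [hβ]
  have hsub : ∀ y ∈ t, Metric.closedBall ((n:ℝ) • y) (n / 2) ⊆ D := by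
    intro y hy x hx g hg
    rw [mem_closedBall_iff_norm] at hx
    obtain ⟨k, hk, hgk⟩ := Set.mem_smul_set.1 hg.1.1
    have hg2 : g = (2:ℝ) • k := by simpa using hgk.symm
    have h1 : ⟪g, y⟫ ≤ 2 := by
      rw [hg2, inner_smul_left]
      have := ht y hy k hk
      simp only [conj_trivial]
      linarith
    have h2 : ‖g‖ ≤ 2 := by simpa using hg.2
    have h3 : ⟪g, x - (n:ℝ) • y⟫ ≤ 2 * (n / 2) := (real_inner_le_norm _ _).trans (by gcongr)
    have h4 : ⟪g, x⟫ = n * ⟪g, y⟫ + ⟪g, x - (n:ℝ) • y⟫ := by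
      rw [inner_sub_right, inner_smul_right]; ring
    rw [h4]
    nlinarith
  have hdisj : (t : Set (E n)).PairwiseDisjoint fun y => Metric.closedBall ((n:ℝ) • y) ((n:ℝ) / 2) := by
    intro x hx y hy hxy
    apply Metric.closedBall_disjoint_closedBall
    rw [dist_smul₀, Real.norm_eq_abs, abs_of_pos hn']
    have := hsep x hx y hy hxy
    nlinarith
  have hsum : ∑ y ∈ t, volume (Metric.closedBall ((n:ℝ) • y) ((n:ℝ) / 2)) ≤ volume D := by
    rw [← measure_biUnion_finset hdisj fun y _ => Metric.isClosed_closedBall.measurableSet]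
    exact measure_mono (Set.iUnion₂_subset hsub)
  have h1 : t.card * ((n/2) ^ n * β) ≤ (volume D).toReal := by
    have := ENNReal.toReal_mono hDfin hsum
    rw [ENNReal.toReal_sum fun y _ => (isCompact_closedBall _ _).measure_lt_top.ne] at this
    simp_rw [hballvol] at this
    simpa using this
  have hB := vol_ball_ge hn
  rw [← hβ] at hB
  set δ := (volume D).toReal with hδ
  have hδ0 : 0 ≤ δ := ENNReal.toReal_nonneg
  have h2 : (t.card * ((n/2) ^ n * β)) * (a ^ n * β) ≤ Real.exp (9 * n) * (4 ^ n * s.card) := by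
    calc _ ≤ δ * (volume K).toReal := by gcongr
      _ ≤ _ := hD
  have e1 : Real.exp (9 * n) = Real.exp 9 ^ n := by rw [mul_comm, Real.exp_nat_mul]
  rw [e1] at h2
  have e2 : (t.card * (((n:ℝ)/2) ^ n * β)) * (a ^ n * β) = t.card * (n ^ n * β ^ 2) * (a ^ n / 2 ^ n) := by
    rw [div_pow]; ring
  rw [e2] at h2
  have h3 : (t.card : ℝ) * (a ^ n / 2 ^ n) ≤ Real.exp 9 ^ n * (4 ^ n * s.card) := by
    refine le_trans ?_ h2
    gcongr
    nlinarith [(Nat.cast_nonneg t.card : (0:ℝ) ≤ t.card)]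
  rw [mul_div_assoc', div_le_iff₀ (by positivity)] at h3
  have e3 : (8 * Real.exp 9 / a) ^ n * s.card = (Real.exp 9 ^ n * (4 ^ n * s.card) * 2 ^ n) / a ^ n := by
    rw [div_pow, mul_pow, (by norm_num : (8:ℝ) = 4 * 2), mul_pow]; ring
  rw [e3, le_div_iff₀ (by positivity)]
  exact h3

end CovPolar

/-- If a convex body `K ⊂ ℝⁿ` with barycenter at the origin satisfies
`N(K, B₂ⁿ) ≤ exp(A₁ n)` and `vr(K) ≥ a₁ > 0`, then
`N(K°, B₂ⁿ) ≤ exp(A₂ n)` with `A₂ = A₁ + log(C/a₁)` for a universal constant `C > 0`. -/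
theorem covering_polar_bound :
    ∃ C : ℝ, 0 < C ∧
      ∀ (n : ℕ) (K : Set (EuclideanSpace ℝ (Fin n))) (A₁ a₁ : ℝ), 0 < a₁ →
        Convex ℝ K → IsCompact K → (interior K).Nonempty →
        (∫ x in K, x) = 0 →
        (∃ s : Finset (EuclideanSpace ℝ (Fin n)),
          (K ⊆ ⋃ x ∈ s, x +ᵥ Metric.closedBall (0 : EuclideanSpace ℝ (Fin n)) 1) ∧
          (s.card : ℝ) ≤ Real.exp (A₁ * n)) →
        a₁ ≤ ((volume K).toReal /
            (volume (Metric.closedBall (0 : EuclideanSpace ℝ (Fin n)) 1)).toReal) ^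
              ((1 : ℝ) / n) →
        ∃ s : Finset (EuclideanSpace ℝ (Fin n)),
          ({y : EuclideanSpace ℝ (Fin n) | ∀ x ∈ K, ⟪x, y⟫ ≤ 1} ⊆
            ⋃ x ∈ s, x +ᵥ Metric.closedBall (0 : EuclideanSpace ℝ (Fin n)) 1) ∧
          (s.card : ℝ) ≤ Real.exp ((A₁ + Real.log (C / a₁)) * n) := by
  refine ⟨8 * Real.exp 9, by positivity, ?_⟩
  rintro n K A₁ a₁ ha hc hK hi hb ⟨s, hs, hcard⟩ hv
  rcases Nat.eq_zero_or_pos n with rfl | hn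
  · refine ⟨{0}, ?_, by simp⟩
    intro y _
    have hy : y = 0 := Subsingleton.elim _ _
    simp [hy]
  have hβ : 0 < (volume (Metric.closedBall (0 : EuclideanSpace ℝ (Fin n)) 1)).toReal :=
    ENNReal.toReal_pos (Metric.measure_closedBall_pos volume _ one_pos).ne'
      (isCompact_closedBall _ _).measure_lt_top.ne
  have hva : a₁ ^ n * (volume (Metric.closedBall (0 : EuclideanSpace ℝ (Fin n)) 1)).toReal
      ≤ (volume K).toReal := by
    rw [← le_div_iff₀ hβ]
    calc a₁ ^ n ≤ _ ^ n := pow_le_pow_left₀ ha.le hv n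
      _ = _ := by
        rw [one_div]
        exact Real.rpow_inv_natCast_pow (by positivity) hn.ne'
  have hs' : ∀ x ∈ K, ∃ c ∈ s, ‖x - c‖ ≤ 1 := by
    intro x hx
    obtain ⟨c, hcs, hxc⟩ := Set.mem_iUnion₂.1 (hs hx)
    refine ⟨c, hcs, ?_⟩
    obtain ⟨z, hz, rfl⟩ := Set.mem_vadd_set.1 hxc
    simpa using hz
  obtain ⟨t, ht, htc⟩ := CovPolar.exists_net
    {y : EuclideanSpace ℝ (Fin n) | ∀ x ∈ K, ⟪x, y⟫ ≤ 1}
    ((8 * Real.exp 9 / a₁) ^ n * s.card) (fun t h1 h2 =>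
      CovPolar.card_bound hn hc hK hi hb s hs' a₁ ha hva t h1 h2)
  refine ⟨t, ?_, ?_⟩
  · intro y hy
    obtain ⟨c, hcs, hyc⟩ := ht y hy
    refine Set.mem_iUnion₂.2 ⟨c, hcs, Set.mem_vadd_set.2 ⟨y - c, ?_, ?_⟩⟩
    · rw [mem_closedBall_zero_iff, ← dist_eq_norm]; exact hyc
    · simp
  · refine htc.trans ?_
    have hp : 0 < 8 * Real.exp 9 / a₁ := by positivity
    have e : Real.exp ((A₁ + Real.log (8 * Real.exp 9 / a₁)) * n)
        = (8 * Real.exp 9 / a₁) ^ n * Real.exp (A₁ * n) := by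
      rw [add_mul, Real.exp_add, mul_comm (Real.log _), Real.exp_nat_mul, Real.exp_log hp,
        mul_comm]
    rw [e]
    gcongr
end

section
/- Let K be a convex body in ℝⁿ with barycenter at the origin. Then vol(K ∩ (−K)) ≥ 2^{−n} vol(K). -/
open MeasureTheory

section aux
open Set
open scoped ENNReal Pointwise

lemma bm_compact {A B : Set ℝ} (hA : IsCompact A) (hB : IsCompact B) (hA' : A.Nonempty)
    (hB' : B.Nonempty) : volume A + volume B ≤ volume (A + B) := by
  obtain ⟨m, hm⟩ := hB.exists_isLeast hB'
  obtain ⟨M, hM⟩ := hA.exists_isGreatest hA'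
  have h1 : volume A = volume ((fun x => x + m) '' A) := by simp
  have h2 : volume B = volume ((fun x => M + x) '' B) := by simp
  have had : AEDisjoint volume ((fun x => x + m) '' A) ((fun x => M + x) '' B) := by
    refine measure_mono_null (t := {M + m}) ?_ (by simp)
    rintro z ⟨⟨x, hx, rfl⟩, ⟨y, hy, hxy⟩⟩
    have := hM.2 hx
    have := hm.2 hy
    simp only [mem_singleton_iff] at *
    linarith
  have hmeas : MeasurableSet ((fun x => M + x) '' B) :=
    (hB.image (by fun_prop)).measurableSet
  rw [h1, h2, ← measure_union₀ hmeas.nullMeasurableSet had]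
  apply measure_mono
  rintro z (⟨x, hx, rfl⟩ | ⟨x, hx, rfl⟩)
  · exact Set.add_mem_add hx hm.1
  · exact Set.add_mem_add hM.1 hx

lemma bm_meas {A B : Set ℝ} (hA : MeasurableSet A) (hB : MeasurableSet B) (hA' : A.Nonempty)
    (hB' : B.Nonempty) : volume A + volume B ≤ volume (A + B) := by
  obtain ⟨x0, hx0⟩ := hA'
  obtain ⟨y0, hy0⟩ := hB'
  have hBl : volume B ≤ volume (A + B) := by
    have : volume B = volume ((fun x => x0 + x) '' B) := by simp
    rw [this]
    apply measure_mono
    rintro z ⟨x, hx, rfl⟩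
    exact Set.add_mem_add hx0 hx
  have hAl : volume A ≤ volume (A + B) := by
    have : volume A = volume ((fun x => x + y0) '' A) := by simp
    rw [this]
    apply measure_mono
    rintro z ⟨x, hx, rfl⟩
    exact Set.add_mem_add hx hy0
  by_cases hA0 : volume A = 0
  · simpa [hA0]
  by_cases hB0 : volume B = 0
  · simpa [hB0]
  rw [hA.measure_eq_iSup_isCompact, hB.measure_eq_iSup_isCompact]
  have key : ∀ K ⊆ A, IsCompact K → ∀ L ⊆ B, IsCompact L →
      volume K + volume L ≤ volume (A + B) := by
    intro K hK hKc L hL hLc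
    have := bm_compact (hKc.union (isCompact_singleton (x := x0)))
      (hLc.union (isCompact_singleton (x := y0))) (by simp) (by simp)
    refine le_trans ?_ (this.trans ?_)
    · gcongr <;> simp
    · apply measure_mono
      exact Set.add_subset_add (union_subset hK (by simpa)) (union_subset hL (by simpa))
  simp only [iSup_and']
  apply ENNReal.biSup_add_biSup_le'
  · exact ⟨∅, by simp⟩
  · exact ⟨∅, by simp⟩
  · rintro K ⟨hK, hKc⟩ L ⟨hL, hLc⟩
    exact key K hK hKc L hL hLc

lemma bm_scaled {A B S : Set ℝ} (hA : MeasurableSet A) (hB : MeasurableSet B) (hA' : A.Nonempty)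
    (hB' : B.Nonempty) {a b : ℝ} (ha : 0 < a) (hb : 0 < b)
    (hS : ∀ x ∈ A, ∀ y ∈ B, a * x + b * y ∈ S) :
    ENNReal.ofReal a * volume A + ENNReal.ofReal b * volume B ≤ volume S := by
  have h := bm_meas (hA.const_smul₀ a) (hB.const_smul₀ b) (hA'.smul_set (a := a))
    (hB'.smul_set (a := b))
  simp only [Measure.addHaar_smul, Module.finrank_self, pow_one, abs_of_pos ha, abs_of_pos hb] at h
  refine h.trans (measure_mono ?_)
  rintro _ ⟨_, ⟨x, hx, rfl⟩, _, ⟨y, hy, rfl⟩, rfl⟩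
  exact hS x hx y hy

lemma amgm {a b : ℝ} (ha : 0 < a) (hb : 0 < b) (hab : a + b = 1) (x y : ℝ≥0∞) :
    x ^ a * y ^ b ≤ ENNReal.ofReal a * x + ENNReal.ofReal b * y := by
  rcases eq_or_ne x ∞ with rfl | hx
  · rw [ENNReal.mul_top (by simpa using ha)]; simp
  rcases eq_or_ne y ∞ with rfl | hy
  · rw [ENNReal.mul_top (by simpa using hb)]; simp
  lift x to NNReal using hx
  lift y to NNReal using hy
  have := NNReal.geom_mean_le_arith_mean2_weighted ⟨a, ha.le⟩ ⟨b, hb.le⟩ x y (NNReal.coe_inj.1 hab)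
  rw [← ENNReal.coe_rpow_of_nonneg _ ha.le, ← ENNReal.coe_rpow_of_nonneg _ hb.le]
  rw [ENNReal.ofReal_eq_coe_nnreal ha.le, ENNReal.ofReal_eq_coe_nnreal hb.le]
  exact_mod_cast this

def PL {α : Type*} [AddCommMonoid α] [Module ℝ α] [MeasureSpace α] (a b : ℝ) : Prop :=
  ∀ f g h : α → ℝ≥0∞, Measurable f → Measurable g → Measurable h →
    (∀ x y, f x ^ a * g y ^ b ≤ h (a • x + b • y)) →
    (∫⁻ x, f x) ^ a * (∫⁻ x, g x) ^ b ≤ ∫⁻ x, h x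

lemma layer {F : ℝ → ℝ≥0∞} (hF : Measurable F) (h1 : ∀ x, F x ≤ 1) :
    ∫⁻ x, F x = ∫⁻ t in Ioi (0:ℝ), volume {x | ENNReal.ofReal t < F x} := by
  have hne : ∀ x, F x ≠ ∞ := fun x => ne_top_of_le_ne_top (by simp) (h1 x)
  have := lintegral_eq_lintegral_meas_lt volume (f := fun x => (F x).toReal)
    (by filter_upwards with x; simp) (hF.ennreal_toReal.aemeasurable)
  simp only [ENNReal.ofReal_toReal (hne _)] at this
  rw [this]
  apply setLIntegral_congr_fun measurableSet_Ioi
  intro t ht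
  simp only
  congr 1
  ext x
  simp [ENNReal.ofReal_lt_iff_lt_toReal (le_of_lt ht) (hne x)]

lemma pl_one_norm {a b : ℝ} (ha : 0 < a) (hb : 0 < b) (hab : a + b = 1)
    (f g h : ℝ → ℝ≥0∞) (hf : Measurable f) (hg : Measurable g) (hh : Measurable h)
    (H : ∀ x y, f x ^ a * g y ^ b ≤ h (a • x + b • y))
    (f1 : ⨆ x, f x = 1) (g1 : ⨆ x, g x = 1) :
    (∫⁻ x, f x) ^ a * (∫⁻ x, g x) ^ b ≤ ∫⁻ x, h x := by
  have f1' : ∀ x, f x ≤ 1 := fun x => f1 ▸ le_iSup f x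
  have g1' : ∀ x, g x ≤ 1 := fun x => g1 ▸ le_iSup g x
  refine (amgm ha hb hab _ _).trans ?_
  refine le_trans ?_ (lintegral_mono (fun x => min_le_left (h x) 1))
  rw [layer hf f1', layer hg g1', layer (hh.min measurable_const) (fun x => min_le_right _ _)]
  have mm : ∀ F : ℝ → ℝ≥0∞, Measurable (fun t : ℝ => volume {x | ENNReal.ofReal t < F x}) := by
    intro F
    apply Antitone.measurable
    intro s t hst
    apply measure_mono
    intro x hx
    exact lt_of_le_of_lt (ENNReal.ofReal_le_ofReal hst) hx
  rw [← lintegral_const_mul _ (mm f), ← lintegral_const_mul _ (mm g),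
    ← lintegral_add_left ((mm f).const_mul _)]
  apply setLIntegral_mono (mm _)
  intro t ht
  have ht0 : ENNReal.ofReal t ≠ 0 := by simpa using ht
  by_cases ht1 : ENNReal.ofReal t < 1
  · apply bm_scaled (measurableSet_lt measurable_const hf) (measurableSet_lt measurable_const hg)
      _ _ ha hb
    · intro x hx y hy
      simp only [mem_ofPred_eq, lt_min_iff] at *
      refine ⟨lt_of_lt_of_le ?_ (H x y), ht1⟩
      calc ENNReal.ofReal t = ENNReal.ofReal t ^ a * ENNReal.ofReal t ^ b := by
            rw [← ENNReal.rpow_add _ _ ht0 (by simp), hab, ENNReal.rpow_one]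
        _ < _ := ENNReal.mul_lt_mul (ENNReal.rpow_lt_rpow hx ha) (ENNReal.rpow_lt_rpow hy hb)
    · rw [← f1] at ht1
      exact lt_iSup_iff.1 ht1
    · rw [← g1] at ht1
      exact lt_iSup_iff.1 ht1
  · have e1 : {x | ENNReal.ofReal t < f x} = ∅ := by
      ext x; simp; exact (f1' x).trans (not_lt.1 ht1)
    have e2 : {x | ENNReal.ofReal t < g x} = ∅ := by
      ext x; simp; exact (g1' x).trans (not_lt.1 ht1)
    simp [e1, e2]

lemma pl_one_bdd {a b : ℝ} (ha : 0 < a) (hb : 0 < b) (hab : a + b = 1)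
    (f g h : ℝ → ℝ≥0∞) (hf : Measurable f) (hg : Measurable g) (hh : Measurable h)
    (H : ∀ x y, f x ^ a * g y ^ b ≤ h (a • x + b • y))
    (f1 : ⨆ x, f x ≠ ∞) (g1 : ⨆ x, g x ≠ ∞) :
    (∫⁻ x, f x) ^ a * (∫⁻ x, g x) ^ b ≤ ∫⁻ x, h x := by
  set M := ⨆ x, f x with hM
  set N := ⨆ x, g x with hN
  by_cases hM0 : M = 0
  · have : ∀ x, f x = 0 := fun x => by
      have := le_iSup f x
      rw [← hM, hM0] at this
      simpa using this
    simp [this, ha]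
  by_cases hN0 : N = 0
  · have : ∀ x, g x = 0 := fun x => by
      have := le_iSup g x
      rw [← hN, hN0] at this
      simpa using this
    simp [this, hb]
  have key := pl_one_norm ha hb hab (fun x => M⁻¹ * f x) (fun x => N⁻¹ * g x)
    (fun x => (M⁻¹ ^ a * N⁻¹ ^ b) * h x) (hf.const_mul _) (hg.const_mul _) (hh.const_mul _)
    (by
      intro x y
      rw [ENNReal.mul_rpow_of_nonneg _ _ ha.le, ENNReal.mul_rpow_of_nonneg _ _ hb.le,
        mul_mul_mul_comm]
      gcongr
      exact H x y)
    (by rw [← ENNReal.mul_iSup, ← hM, ENNReal.inv_mul_cancel hM0 f1])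
    (by rw [← ENNReal.mul_iSup, ← hN, ENNReal.inv_mul_cancel hN0 g1])
  rw [lintegral_const_mul _ hf, lintegral_const_mul _ hg, lintegral_const_mul _ hh,
    ENNReal.mul_rpow_of_nonneg _ _ ha.le, ENNReal.mul_rpow_of_nonneg _ _ hb.le,
        mul_mul_mul_comm] at key
  refine (ENNReal.mul_le_mul_iff_right ?_ ?_).1 key
  · simp [ENNReal.rpow_eq_zero_iff, ha, hb, f1, g1, ha.not_gt, hb.not_gt]
  · apply ENNReal.mul_ne_top <;> simp [ENNReal.rpow_eq_top_iff, hM0, hN0, ha.not_gt, hb.not_gt]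

lemma pl_one {a b : ℝ} (ha : 0 < a) (hb : 0 < b) (hab : a + b = 1) : PL (α := ℝ) a b := by
  intro f g h hf hg hh H
  by_cases hf0 : ∫⁻ x, f x = 0
  · simp [hf0, ha]
  by_cases hg0 : ∫⁻ x, g x = 0
  · simp [hg0, hb]
  have lim : ∀ F : ℝ → ℝ≥0∞, Measurable F → Filter.Tendsto (fun k : ℕ => ∫⁻ x, min (F x) k)
      Filter.atTop (nhds (∫⁻ x, F x)) := by
    intro F hF
    apply lintegral_tendsto_of_tendsto_of_monotone
    · intro k; exact (hF.min measurable_const).aemeasurable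
    · filter_upwards with x
      intro k l hkl
      simp only
      gcongr
    · filter_upwards with x
      have : Filter.Tendsto (fun k : ℕ => min (F x) k) Filter.atTop (nhds (min (F x) ∞)) :=
        tendsto_const_nhds.min ENNReal.tendsto_nat_nhds_top
      simpa using this
  have key : ∀ k : ℕ, (∫⁻ x, min (f x) k) ^ a * (∫⁻ x, min (g x) k) ^ b ≤ ∫⁻ x, h x := by
    intro k
    apply pl_one_bdd ha hb hab _ _ _ (hf.min measurable_const) (hg.min measurable_const) hh
    · intro x y
      refine le_trans ?_ (H x y)
      gcongr <;> exact min_le_left _ _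
    · exact ne_top_of_le_ne_top (ENNReal.natCast_ne_top k) (iSup_le fun x => min_le_right _ _)
    · exact ne_top_of_le_ne_top (ENNReal.natCast_ne_top k) (iSup_le fun x => min_le_right _ _)
  refine le_of_tendsto (ENNReal.Tendsto.mul ((lim f hf).ennrpow_const a) (Or.inl ?_)
    ((lim g hg).ennrpow_const b) (Or.inl ?_)) (Filter.Eventually.of_forall key)
  · simp [ENNReal.rpow_eq_zero_iff, hf0, ha.not_gt]
  · simp [ENNReal.rpow_eq_zero_iff, hg0, hb.not_gt]

lemma pl_transfer {α β : Type*} [AddCommMonoid α] [Module ℝ α] [MeasureSpace α]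
    [AddCommMonoid β] [Module ℝ β] [MeasureSpace β] {a b : ℝ} (e : α → β)
    (he : MeasurePreserving e) (hl : ∀ x y, e (a • x + b • y) = a • e x + b • e y)
    (H : PL (α := α) a b) : PL (α := β) a b := by
  intro f g h hf hg hh hfg
  have := H (f ∘ e) (g ∘ e) (h ∘ e) (hf.comp he.measurable) (hg.comp he.measurable)
    (hh.comp he.measurable) (fun x y => by
      simp only [Function.comp, hl]; exact hfg _ _)
  simpa only [Function.comp, he.lintegral_comp hf, he.lintegral_comp hg,
    he.lintegral_comp hh] using this

lemma pl_prod {α β : Type*} [AddCommMonoid α] [Module ℝ α] [MeasureSpace α]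
    [AddCommMonoid β] [Module ℝ β] [MeasureSpace β]
    [SFinite (volume : Measure β)] [SFinite (volume : Measure α)] {a b : ℝ}
    (H1 : PL (α := α) a b) (H2 : PL (α := β) a b) : PL (α := α × β) a b := by
  intro f g h hf hg hh hfg
  rw [Measure.volume_eq_prod, lintegral_prod _ hf.aemeasurable, lintegral_prod _ hg.aemeasurable,
    lintegral_prod _ hh.aemeasurable]
  apply H1 _ _ _ hf.lintegral_prod_right' hg.lintegral_prod_right' hh.lintegral_prod_right'
  intro x y
  apply H2 _ _ _ (hf.comp measurable_prodMk_left) (hg.comp measurable_prodMk_left)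
    (hh.comp measurable_prodMk_left)
  intro u v
  exact hfg (x, u) (y, v)

lemma pl_pi {a b : ℝ} (ha : 0 < a) (hb : 0 < b) (hab : a + b = 1) (n : ℕ) :
    PL (α := Fin n → ℝ) a b := by
  induction n with
  | zero =>
    intro f g h hf hg hh H
    simp only [lintegral_unique]
    have hv : (volume : Measure (Fin 0 → ℝ)) univ = 1 := by
      rw [volume_pi, Measure.pi_of_empty (x := default)]
      exact measure_univ
    simp only [hv, mul_one]
    convert! H default default
  | succ n ih =>
    refine pl_transfer _ ((volume_preserving_piFinSuccAbove (fun _ => ℝ) 0).symm) ?_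
      (pl_prod (pl_one ha hb hab) ih)
    intro x y
    ext i
    refine Fin.cases ?_ (fun i => ?_) i <;> rfl

lemma pl_euc {a b : ℝ} (ha : 0 < a) (hb : 0 < b) (hab : a + b = 1) (n : ℕ) :
    PL (α := EuclideanSpace ℝ (Fin n)) a b :=
  pl_transfer _ (PiLp.volume_preserving_toLp (Fin n)) (fun _ _ => rfl) (pl_pi ha hb hab n)

section main
variable {n : ℕ}

noncomputable def cv (U : Set (EuclideanSpace ℝ (Fin n))) (x : EuclideanSpace ℝ (Fin n)) : ℝ≥0∞ :=
  volume (U ∩ {z | x - z ∈ U})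

lemma cv_meas_set {U : Set (EuclideanSpace ℝ (Fin n))} (hU : IsOpen U) (x : (EuclideanSpace ℝ (Fin n))) : IsOpen (U ∩ {z | x - z ∈ U}) :=
  hU.inter (hU.preimage (by fun_prop))

lemma cv_eq {U : Set (EuclideanSpace ℝ (Fin n))} (hU : IsOpen U) (x : (EuclideanSpace ℝ (Fin n))) :
    cv U x = ∫⁻ z, U.indicator 1 z * U.indicator 1 (x - z) := by
  rw [cv, ← lintegral_indicator_one (cv_meas_set hU x).measurableSet]
  congr 1
  ext z
  by_cases h1 : z ∈ U <;> by_cases h2 : x - z ∈ U <;> simp [h1, h2, indicator]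

lemma cv_logconc {U : Set (EuclideanSpace ℝ (Fin n))} (hU : IsOpen U) (hc : Convex ℝ U) {a b : ℝ} (ha : 0 < a) (hb : 0 < b)
    (hab : a + b = 1) (x y : (EuclideanSpace ℝ (Fin n))) : cv U x ^ a * cv U y ^ b ≤ cv U (a • x + b • y) := by
  simp only [cv]
  rw [← lintegral_indicator_one (cv_meas_set hU _).measurableSet,
    ← lintegral_indicator_one (cv_meas_set hU _).measurableSet,
    ← lintegral_indicator_one (cv_meas_set hU _).measurableSet]
  apply pl_euc ha hb hab n
  · exact measurable_one.indicator (cv_meas_set hU _).measurableSet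
  · exact measurable_one.indicator (cv_meas_set hU _).measurableSet
  · exact measurable_one.indicator (cv_meas_set hU _).measurableSet
  intro z w
  by_cases hz : z ∈ U ∩ {z | x - z ∈ U}
  · by_cases hw : w ∈ U ∩ {z | y - z ∈ U}
    · have : a • z + b • w ∈ U ∩ {z | a • x + b • y - z ∈ U} := by
        refine ⟨hc hz.1 hw.1 ha.le hb.le hab, ?_⟩
        have := hc hz.2 hw.2 ha.le hb.le hab
        simp only [mem_ofPred_eq]
        convert! this using 1
        module
      rw [indicator_of_mem hz, indicator_of_mem hw, indicator_of_mem this]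
      simp
    · rw [indicator_of_notMem hw]; simp [hb]
  · rw [indicator_of_notMem hz]; simp [ha]

lemma cv_lsc {U : Set (EuclideanSpace ℝ (Fin n))} (hU : IsOpen U) : LowerSemicontinuous (cv U) := by
  intro x c hc
  obtain ⟨L, hL, hLc, hcL⟩ := (cv_meas_set hU x).exists_lt_isCompact hc
  have : ∀ᶠ y in nhds x, ∀ z ∈ L, y - z ∈ U := by
    apply hLc.eventually_forall_of_forall_eventually
    intro z hz
    have : Continuous (fun p : (EuclideanSpace ℝ (Fin n)) × (EuclideanSpace ℝ (Fin n)) => p.1 - p.2) := by fun_prop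
    exact this.continuousAt.eventually_mem (hU.mem_nhds (hL hz).2)
  filter_upwards [this] with y hy
  exact hcL.trans_le (measure_mono fun z hz => ⟨(hL hz).1, hy z hz⟩)

lemma cv_support {U : Set (EuclideanSpace ℝ (Fin n))} (hU : IsOpen U) (hc : Convex ℝ U) (h0 : (0 : (EuclideanSpace ℝ (Fin n))) ∈ U)
    (hfin : volume U ≠ ∞) : ∃ l : StrongDual ℝ (EuclideanSpace ℝ (Fin n)), ∀ x,
      cv U x * ENNReal.ofReal (Real.exp (-l x)) ≤ cv U 0 := by
  have hft : ∀ x, cv U x ≠ ∞ := fun x => ne_top_of_le_ne_top hfin (measure_mono inter_subset_left)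
  have hf0 : cv U 0 ≠ 0 := ((cv_meas_set hU 0).measure_pos _ ⟨0, by simpa using h0⟩).ne'
  set f0 := (cv U 0).toReal with hf0d
  have hf0p : 0 < f0 := ENNReal.toReal_pos hf0 (hft 0)
  let C : Set ((EuclideanSpace ℝ (Fin n)) × ℝ) := {p | ENNReal.ofReal (Real.exp p.2) < cv U p.1}
  have memC : ∀ x s, (x, s) ∈ C ↔ Real.exp s < (cv U x).toReal := by
    intro x s
    exact ENNReal.ofReal_lt_iff_lt_toReal (Real.exp_pos s).le (hft x)
  have hCo : IsOpen C := by
    rw [isOpen_iff_mem_nhds]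
    rintro ⟨x, s⟩ hp
    obtain ⟨c, hc1, hc2⟩ := exists_between (show ENNReal.ofReal (Real.exp s) < cv U x from hp)
    have h1 : ∀ᶠ q : (EuclideanSpace ℝ (Fin n)) × ℝ in nhds (x, s), c < cv U q.1 :=
      (continuous_fst.tendsto (x, s)).eventually (cv_lsc hU x c hc2)
    have hcont : Continuous (fun q : (EuclideanSpace ℝ (Fin n)) × ℝ => ENNReal.ofReal (Real.exp q.2)) :=
      ENNReal.continuous_ofReal.comp (by fun_prop)
    have h2 : ∀ᶠ q : (EuclideanSpace ℝ (Fin n)) × ℝ in nhds (x, s), ENNReal.ofReal (Real.exp q.2) < c :=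
      hcont.continuousAt.eventually_lt_const hc1
    filter_upwards [h1, h2] with q hq1 hq2
    exact hq2.trans hq1
  have hCc : Convex ℝ C := by
    rw [convex_iff_forall_pos]
    rintro ⟨x, s⟩ hx ⟨y, r⟩ hy a b ha hb hab
    have hx' : ENNReal.ofReal (Real.exp s) < cv U x := hx
    have hy' : ENNReal.ofReal (Real.exp r) < cv U y := hy
    change ENNReal.ofReal (Real.exp (a * s + b * r)) < cv U (a • x + b • y)
    refine lt_of_lt_of_le ?_ (cv_logconc hU hc ha hb hab x y)
    have : ENNReal.ofReal (Real.exp (a * s + b * r)) =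
        ENNReal.ofReal (Real.exp s) ^ a * ENNReal.ofReal (Real.exp r) ^ b := by
      rw [ENNReal.ofReal_rpow_of_pos (Real.exp_pos _), ENNReal.ofReal_rpow_of_pos (Real.exp_pos _),
        ← ENNReal.ofReal_mul (by positivity), ← Real.exp_mul, ← Real.exp_mul, ← Real.exp_add]
      ring_nf
    rw [this]
    exact ENNReal.mul_lt_mul (ENNReal.rpow_lt_rpow hx' ha) (ENNReal.rpow_lt_rpow hy' hb)
  have hnot : ((0 : (EuclideanSpace ℝ (Fin n))), Real.log f0) ∉ C := by
    rw [memC, Real.exp_log hf0p]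
    exact lt_irrefl _
  obtain ⟨φ, hφ⟩ := geometric_hahn_banach_open_point hCc hCo hnot
  set a := φ (0, 1) with ha
  have hsplit : ∀ x s, φ (x, s) = φ (x, 0) + s * a := by
    intro x s
    have : ((x, s) : (EuclideanSpace ℝ (Fin n)) × ℝ) = (x, 0) + s • (0, 1) := by simp
    rw [this, map_add, map_smul, smul_eq_mul]
  have hz : φ ((0 : (EuclideanSpace ℝ (Fin n))), (0 : ℝ)) = 0 := by
    have : ((0 : (EuclideanSpace ℝ (Fin n))), (0 : ℝ)) = 0 := rfl
    rw [this, map_zero]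
  have hapos : 0 < a := by
    have := hφ (0, Real.log f0 - 1) (by
      rw [memC, Real.exp_sub, Real.exp_log hf0p]
      exact div_lt_self hf0p (by simp))
    rw [hsplit, hsplit 0 (Real.log f0)] at this
    linarith
  refine ⟨-(a⁻¹ • φ.comp (ContinuousLinearMap.inl ℝ (EuclideanSpace ℝ (Fin n)) ℝ)), fun x => ?_⟩
  have hl : -((-(a⁻¹ • φ.comp (ContinuousLinearMap.inl ℝ (EuclideanSpace ℝ (Fin n)) ℝ)) : StrongDual ℝ (EuclideanSpace ℝ (Fin n))) x) =
    a⁻¹ * φ (x, 0) := by simp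
  rw [hl]
  by_cases hx0 : cv U x = 0
  · simp [hx0]
  have hxp : 0 < (cv U x).toReal := ENNReal.toReal_pos hx0 (hft x)
  rw [← ENNReal.ofReal_toReal (hft x), ← ENNReal.ofReal_toReal (hft 0),
    ← ENNReal.ofReal_mul hxp.le]
  apply ENNReal.ofReal_le_ofReal
  have hlog : Real.log (cv U x).toReal ≤ Real.log f0 - a⁻¹ * φ (x, 0) := by
    apply le_of_forall_lt
    intro s hs
    have := hφ (x, s) (by rw [memC]; exact (Real.lt_log_iff_exp_lt hxp).1 hs)
    rw [hsplit, hsplit 0 (Real.log f0), hz] at this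
    have h3 : a⁻¹ * (φ (x, 0) + s * a) < a⁻¹ * (0 + Real.log f0 * a) :=
      mul_lt_mul_of_pos_left this (by positivity)
    have e1 : a⁻¹ * (φ (x, 0) + s * a) = a⁻¹ * φ (x, 0) + s := by field_simp
    have e2 : a⁻¹ * (0 + Real.log f0 * a) = Real.log f0 := by field_simp; ring
    linarith
  calc (cv U x).toReal * Real.exp (a⁻¹ * φ (x, 0))
      = Real.exp (Real.log (cv U x).toReal + a⁻¹ * φ (x, 0)) := by
        rw [Real.exp_add, Real.exp_log hxp]
    _ ≤ Real.exp (Real.log f0) := Real.exp_le_exp.2 (by linarith)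
    _ = f0 := Real.exp_log hf0p

lemma cv_int {U : Set (EuclideanSpace ℝ (Fin n))} (hU : IsOpen U) (l : StrongDual ℝ (EuclideanSpace ℝ (Fin n))) :
    ∫⁻ x, cv U x * ENNReal.ofReal (Real.exp (-l x)) =
      (∫⁻ z in U, ENNReal.ofReal (Real.exp (-l z))) ^ 2 := by
  set w : (EuclideanSpace ℝ (Fin n)) → ℝ≥0∞ := U.indicator (fun z => ENNReal.ofReal (Real.exp (-l z))) with hw
  have hwm : Measurable w := by
    apply Measurable.indicator _ hU.measurableSet
    have : Continuous (fun z => ENNReal.ofReal (Real.exp (-l z))) :=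
      ENNReal.continuous_ofReal.comp (by fun_prop)
    exact this.measurable
  have e : ∀ x, cv U x * ENNReal.ofReal (Real.exp (-l x)) = ∫⁻ z, w z * w (x - z) := by
    intro x
    rw [cv_eq hU, ← lintegral_mul_const']
    · congr 1
      ext z
      by_cases h1 : z ∈ U <;> by_cases h2 : x - z ∈ U <;> simp [h1, h2, hw, indicator]
      rw [← ENNReal.ofReal_mul (by positivity), ← Real.exp_add]
      congr 2
      ring
    · simp
  simp_rw [e]
  rw [lintegral_lintegral_swap]
  · have : ∀ z, ∫⁻ x, w z * w (x - z) = w z * ∫⁻ x, w x := by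
      intro z
      rw [lintegral_const_mul _ (by fun_prop), lintegral_sub_right_eq_self]
    simp_rw [this]
    rw [lintegral_mul_const _ hwm, hw, lintegral_indicator hU.measurableSet, sq]
  · exact Measurable.aemeasurable (by fun_prop)

end main

theorem milman_pajor_aux
    {n : ℕ} (K : Set (EuclideanSpace ℝ (Fin n)))
    (hconv : Convex ℝ K) (hcomp : IsCompact K) (hint : (interior K).Nonempty)
    (hbar : (∫ x in K, x) = 0) :
    volume K / 2 ^ n ≤ volume (K ∩ (-K)) := by
  set U := interior K with hUd
  have hU : IsOpen U := isOpen_interior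
  have hUc : Convex ℝ U := hconv.interior
  have hUK : U =ᵐ[volume] K := interior_ae_eq_of_null_frontier (hconv.addHaar_frontier volume)
  have hvol : volume U = volume K := measure_congr hUK
  have hfin : volume U ≠ ∞ := hvol ▸ hcomp.measure_lt_top.ne
  have hpos : volume U ≠ 0 := (hU.measure_pos _ hint).ne'
  have hid : IntegrableOn (fun x : EuclideanSpace ℝ (Fin n) => x) U :=
    (continuous_id.continuousOn.integrableOn_compact hcomp).mono_set interior_subset
  have hlint : ∀ l : StrongDual ℝ (EuclideanSpace ℝ (Fin n)), IntegrableOn (fun x => l x) U :=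
    fun l => l.integrable_comp hid
  have hl0 : ∀ l : StrongDual ℝ (EuclideanSpace ℝ (Fin n)), ∫ x in U, l x = 0 := by
    intro l
    rw [l.integral_comp_comm hid, setIntegral_congr_set hUK, hbar, map_zero]
  have h0 : (0 : EuclideanSpace ℝ (Fin n)) ∈ U := by
    by_contra h
    obtain ⟨l, hl⟩ := geometric_hahn_banach_open_point hUc hU h
    rw [map_zero] at hl
    have h1 : 0 < ∫ x in U, -l x := by
      rw [setIntegral_pos_iff_support_of_nonneg_ae]
      · refine lt_of_lt_of_le (pos_iff_ne_zero.2 hpos) (measure_mono fun x hx => ⟨?_, hx⟩)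
        have := hl x hx
        simp only [Function.mem_support]
        linarith
      · filter_upwards [ae_restrict_mem hU.measurableSet] with x hx
        have := hl x hx
        simp only [Pi.zero_apply]
        linarith
      · exact (hlint l).neg
    rw [integral_neg, hl0] at h1
    simp at h1
  obtain ⟨l, hl⟩ := cv_support hU hUc h0 hfin
  have hI : volume U ≤ ∫⁻ z in U, ENNReal.ofReal (Real.exp (-l z)) := by
    have hfi : IntegrableOn (fun z => Real.exp (-l z)) U := by
      have hct : Continuous (fun z => Real.exp (-l z)) := by fun_prop
      exact (hct.continuousOn.integrableOn_compact hcomp).mono_set interior_subset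
    rw [← ofReal_integral_eq_lintegral_ofReal hfi
      (by filter_upwards with z using (Real.exp_pos _).le)]
    have hone : Integrable (fun _ : EuclideanSpace ℝ (Fin n) => (1 : ℝ)) (volume.restrict U) :=
      integrableOn_const hfin
    have h1 : ∫ z in U, (1 - l z) ≤ ∫ z in U, Real.exp (-l z) := by
      apply integral_mono _ hfi
      · intro z
        have := Real.add_one_le_exp (-l z)
        simp only
        linarith
      · exact Integrable.sub hone (hlint l)
    rw [integral_sub hone (hlint l), hl0] at h1
    simp only [integral_const, smul_eq_mul, mul_one, sub_zero, measureReal_restrict_apply_univ] at h1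
    rw [← ENNReal.ofReal_toReal hfin]
    exact ENNReal.ofReal_le_ofReal h1
  have hup : ∫⁻ x, cv U x * ENNReal.ofReal (Real.exp (-l x)) ≤ cv U 0 * (2 ^ n * volume U) := by
    have h2 : volume ((2 : ℝ) • U) = 2 ^ n * volume U := by
      rw [Measure.addHaar_smul, finrank_euclideanSpace_fin, abs_of_pos (by positivity),
        ENNReal.ofReal_pow (by norm_num)]
      norm_num
    rw [← h2, ← setLIntegral_const, ← lintegral_indicator (hU.smul₀ (by norm_num)).measurableSet]
    apply lintegral_mono
    intro x
    by_cases hx : x ∈ (2 : ℝ) • U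
    · simpa only [indicator_of_mem hx] using hl x
    · have : cv U x = 0 := by
        have : U ∩ {z | x - z ∈ U} = ∅ := by
          ext z
          simp only [mem_inter_iff, mem_ofPred_eq, mem_empty_iff_false, iff_false, not_and]
          intro hz hz'
          apply hx
          refine ⟨_, hUc hz hz' (a := 1 / 2) (b := 1 / 2) (by norm_num) (by norm_num)
            (by norm_num), ?_⟩
          simp only
          module
        rw [cv, this, measure_empty]
      simp [this]
  rw [cv_int hU] at hup
  have hmain : volume U * volume U ≤ (cv U 0 * 2 ^ n) * volume U := by
    calc volume U * volume U = volume U ^ 2 := (sq _).symm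
      _ ≤ _ := by gcongr
      _ ≤ _ := hup
      _ = _ := by ring
  have hfinal : volume U ≤ cv U 0 * 2 ^ n := (ENNReal.mul_le_mul_iff_left hpos hfin).1 hmain
  rw [← hvol]
  refine (ENNReal.div_le_of_le_mul hfinal).trans (measure_mono ?_)
  rintro z ⟨hz, hz'⟩
  refine ⟨interior_subset hz, ?_⟩
  simp only [mem_ofPred_eq, zero_sub] at hz'
  exact Set.mem_neg.2 (interior_subset (s := K) hz')

end aux

/-- Milman–Pajor inequality: if `K` is a convex body in `ℝⁿ` with barycenter at the
origin, then `vol(K ∩ (−K)) ≥ 2^{−n} vol(K)`. -/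
theorem milman_pajor
    {n : ℕ} (K : Set (EuclideanSpace ℝ (Fin n)))
    (hconv : Convex ℝ K) (hcomp : IsCompact K) (hint : (interior K).Nonempty)
    (hbar : (∫ x in K, x) = 0) :
    volume K / 2 ^ n ≤ volume (K ∩ (-K)) := by
  exact milman_pajor_aux K hconv hcomp hint hbar
end

section
/- Let L ⊂ ℝⁿ (n ≥ 2) be a compact set with covering number N(L, B₂ⁿ) ≤ exp(A₁ n). If U is a Haar-uniform random orthogonal map, then P( L ∩ U(L) ⊆ A₃ B₂ⁿ ) ≥ 1 − exp(−A₂ n), where A₂ = A₁ + (log 2)/2 and A₃ = C' exp(6 A₁) for a universal constant C' > 0. -/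
open MeasureTheory Real
open scoped Pointwise

/-- If `L ⊂ ℝⁿ` (`n ≥ 2`) is compact with covering number `N(L, B₂ⁿ) ≤ exp(A₁ n)` and `U` is a
Haar-uniform random orthogonal map, then `L ∩ U(L) ⊆ C' exp(6A₁) B₂ⁿ` with probability at least
`1 − exp(−(A₁ + (log 2)/2) n)`, for a universal constant `C' > 0`. -/
noncomputable instance {n : ℕ} : MeasurableSpace (Matrix (Fin n) (Fin n) ℝ) := borel _

instance {n : ℕ} : BorelSpace (Matrix (Fin n) (Fin n) ℝ) := ⟨rfl⟩

/-- The action of an orthogonal matrix on Euclidean space. -/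
noncomputable def rri_act {n : ℕ} (U : Matrix.orthogonalGroup (Fin n) ℝ)
    (x : EuclideanSpace ℝ (Fin n)) : EuclideanSpace ℝ (Fin n) :=
  Matrix.toEuclideanLin (U : Matrix (Fin n) (Fin n) ℝ) x

lemma rri_act_mul {n : ℕ} (g U : Matrix.orthogonalGroup (Fin n) ℝ)
    (x : EuclideanSpace ℝ (Fin n)) : rri_act (g * U) x = rri_act g (rri_act U x) := by
  simp [rri_act, Matrix.toLpLin_apply, Matrix.mulVec_mulVec]

lemma rri_act_sub {n : ℕ} (g : Matrix.orthogonalGroup (Fin n) ℝ)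
    (x y : EuclideanSpace ℝ (Fin n)) : rri_act g (x - y) = rri_act g x - rri_act g y := by
  simp [rri_act]

lemma rri_norm_act {n : ℕ} (g : Matrix.orthogonalGroup (Fin n) ℝ)
    (x : EuclideanSpace ℝ (Fin n)) : ‖rri_act g x‖ = ‖x‖ := by
  have hg : (g : Matrix (Fin n) (Fin n) ℝ) ∈ unitary (Matrix (Fin n) (Fin n) ℝ) := g.2
  let T : unitary (EuclideanSpace ℝ (Fin n) →L[ℝ] EuclideanSpace ℝ (Fin n)) :=
    ⟨Matrix.toEuclideanCLM (𝕜 := ℝ) (g : Matrix (Fin n) (Fin n) ℝ),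
      Unitary.map_mem (Matrix.toEuclideanCLM (𝕜 := ℝ) (n := Fin n)) hg⟩
  have h := (Unitary.linearIsometryEquiv T).norm_map x
  exact h

lemma rri_trans {n : ℕ} (x y : EuclideanSpace ℝ (Fin n)) (h : ‖x‖ = ‖y‖) :
    ∃ g : Matrix.orthogonalGroup (Fin n) ℝ, rri_act g x = y := by
  let e := (ℝ ∙ (x - y))ᗮ.reflection
  let T := Unitary.linearIsometryEquiv.symm e
  refine ⟨⟨(Matrix.toEuclideanCLM (𝕜 := ℝ) (n := Fin n)).symm T,
    Unitary.map_mem (Matrix.toEuclideanCLM (𝕜 := ℝ) (n := Fin n)).symm T.2⟩, ?_⟩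
  have h1 : e x = y := Submodule.reflection_sub h
  have h2 : Matrix.toEuclideanCLM (𝕜 := ℝ) (n := Fin n)
      ((Matrix.toEuclideanCLM (𝕜 := ℝ) (n := Fin n)).symm T) x = y := by
    rw [StarAlgEquiv.apply_symm_apply]
    exact h1
  exact h2

lemma rri_measurable {n : ℕ} (v : EuclideanSpace ℝ (Fin n)) :
    Measurable (fun U : Matrix.orthogonalGroup (Fin n) ℝ => rri_act U v) := by
  apply Continuous.measurable
  unfold rri_act
  simp only [Matrix.toLpLin_apply]
  have : Continuous (fun U : Matrix.orthogonalGroup (Fin n) ℝ =>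
      (U : Matrix (Fin n) (Fin n) ℝ).mulVec v.ofLp) :=
    Continuous.matrix_mulVec continuous_subtype_val continuous_const
  exact (PiLp.continuous_toLp 2 _).comp this

lemma rri_annulus {n : ℕ} (hn : 1 ≤ n) (r : ℝ) (hr : 1 ≤ r) :
    ENNReal.ofReal (r ^ (n - 1)) * volume (Metric.ball (0 : EuclideanSpace ℝ (Fin n)) 1) ≤
      volume (Metric.closedBall (0 : EuclideanSpace ℝ (Fin n)) r \ Metric.ball 0 (r - 1)) := by
  have : Nonempty (Fin n) := ⟨⟨0, hn⟩⟩
  have : Nontrivial (EuclideanSpace ℝ (Fin n)) := inferInstance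
  refine le_trans ?_ (le_measure_sdiff ..)
  rw [Measure.addHaar_closedBall volume (0 : EuclideanSpace ℝ (Fin n)) (by linarith : 0 ≤ r),
    Measure.addHaar_ball volume (0 : EuclideanSpace ℝ (Fin n)) (by linarith : 0 ≤ r - 1),
    finrank_euclideanSpace_fin, ← ENNReal.sub_mul (fun _ _ => measure_ball_lt_top.ne),
    ← ENNReal.ofReal_sub _ (by apply pow_nonneg; linarith)]
  gcongr
  obtain ⟨k, rfl⟩ : ∃ k, n = k + 1 := ⟨n - 1, by omega⟩
  simp only [Nat.add_sub_cancel]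
  have h : (r - 1) ^ k ≤ r ^ k := pow_le_pow_left₀ (by linarith) (by linarith) k
  have h2 : (r - 1) ^ k * (r - 1) ≤ r ^ k * (r - 1) := by
    apply mul_le_mul_of_nonneg_right h; linarith
  rw [pow_succ, pow_succ]
  linarith

lemma rri_cap {n : ℕ} (hn : 1 ≤ n) (μ : Measure (Matrix.orthogonalGroup (Fin n) ℝ))
    [IsProbabilityMeasure μ] [μ.IsMulLeftInvariant] (v w : EuclideanSpace ℝ (Fin n))
    (hw : 1 ≤ ‖w‖) :
    μ {U | ‖rri_act U v - w‖ ≤ 2} * ENNReal.ofReal (‖w‖ ^ (n - 1)) ≤ ENNReal.ofReal (3 ^ n) := by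
  set p := μ {U | ‖rri_act U v - w‖ ≤ 2} with hp
  set r := ‖w‖ with hr
  set A := Metric.closedBall (0 : EuclideanSpace ℝ (Fin n)) r \ Metric.ball 0 (r - 1) with hA
  have hAm : MeasurableSet A := measurableSet_closedBall.diff measurableSet_ball
  -- lower bound of each slice
  have key : ∀ y ∈ A, p ≤ μ {U | ‖rri_act U v - y‖ ≤ 3} := by
    intro y hy
    obtain ⟨z, hz, hzy⟩ : ∃ z : EuclideanSpace ℝ (Fin n), ‖w‖ = ‖z‖ ∧ ‖z - y‖ ≤ 1 := by
      have h1 : ‖y‖ ≤ r := by simpa using hy.1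
      have h2 : r - 1 ≤ ‖y‖ := by simpa using hy.2
      by_cases hy0 : ‖y‖ = 0
      · refine ⟨w, rfl, ?_⟩
        have : y = 0 := norm_eq_zero.1 hy0
        subst this
        simp only [sub_zero]
        linarith
      · have hpos : 0 < ‖y‖ := lt_of_le_of_ne (norm_nonneg _) (Ne.symm hy0)
        refine ⟨(r / ‖y‖) • y, ?_, ?_⟩
        · rw [norm_smul, Real.norm_of_nonneg (by positivity), div_mul_cancel₀ _ hy0]
        · have : (r / ‖y‖) • y - y = (r / ‖y‖ - 1) • y := by rw [sub_smul, one_smul]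
          rw [this, norm_smul, Real.norm_of_nonneg, sub_mul, div_mul_cancel₀ _ hy0]
          · linarith
          · rw [sub_nonneg, le_div_iff₀ hpos]; linarith
    obtain ⟨g, hg⟩ := rri_trans w z hz
    rw [← measure_preimage_mul μ g {U | ‖rri_act U v - y‖ ≤ 3}]
    apply measure_mono
    intro U hU
    simp only [Set.mem_ofPred_eq, Set.mem_preimage] at hU ⊢
    rw [rri_act_mul]
    have e : rri_act g (rri_act U v) - y = rri_act g (rri_act U v - w) + (z - y) := by
      rw [rri_act_sub, hg]; abel
    rw [e]
    refine (norm_add_le _ _).trans ?_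
    rw [rri_norm_act]
    linarith
  have hS : MeasurableSet {q : EuclideanSpace ℝ (Fin n) × Matrix.orthogonalGroup (Fin n) ℝ |
      ‖rri_act q.2 v - q.1‖ ≤ 3} := by
    apply measurableSet_le _ measurable_const
    exact (((rri_measurable v).comp measurable_snd).sub measurable_fst).norm
  set V := volume (Metric.ball (0 : EuclideanSpace ℝ (Fin n)) 1) with hV
  have hV0 : V ≠ 0 := (Metric.measure_ball_pos _ _ one_pos).ne'
  have hVt : V ≠ ⊤ := measure_ball_lt_top.ne
  have main : p * volume A ≤ ENNReal.ofReal (3 ^ n) * V := by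
    calc p * volume A = ∫⁻ _ in A, p := by rw [setLIntegral_const]
      _ ≤ ∫⁻ y in A, μ {U | ‖rri_act U v - y‖ ≤ 3} := setLIntegral_mono' hAm key
      _ ≤ ∫⁻ y, μ {U | ‖rri_act U v - y‖ ≤ 3} := setLIntegral_le_lintegral _ _
      _ = (volume.prod μ) {q : EuclideanSpace ℝ (Fin n) × Matrix.orthogonalGroup (Fin n) ℝ |
            ‖rri_act q.2 v - q.1‖ ≤ 3} := (Measure.prod_apply hS).symm
      _ = ∫⁻ U, volume {y | ‖rri_act U v - y‖ ≤ 3} ∂μ := Measure.prod_apply_symm hS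
      _ = ∫⁻ U, ENNReal.ofReal (3 ^ n) * V ∂μ := by
          congr 1
          ext U
          have : {y | ‖rri_act U v - y‖ ≤ 3} = Metric.closedBall (rri_act U v) 3 := by
            ext y; simp [dist_eq_norm, norm_sub_rev]
          rw [this, Measure.addHaar_closedBall _ _ (by norm_num), finrank_euclideanSpace_fin]
      _ = ENNReal.ofReal (3 ^ n) * V := by simp
  have h := (mul_le_mul_right (rri_annulus hn r hw) p).trans main
  rw [← mul_assoc] at h
  exact (ENNReal.mul_le_mul_iff_left hV0 hVt).1 h

/-- The numerical estimate. -/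
lemma rri_num (n : ℕ) (hn : 2 ≤ n) (A r : ℝ) (hA : 0 ≤ A) (hr : 18 * Real.exp (6 * A) ≤ r) :
    Real.exp (A * n) * Real.exp (A * n) * (3 ^ n / r ^ (n - 1)) ≤
      Real.exp (-(A + Real.log 2 / 2) * n) := by
  have hr0 : 0 < r := lt_of_lt_of_le (by positivity) hr
  rw [← mul_div_assoc, div_le_iff₀ (by positivity)]
  have h1 : (18 * Real.exp (6 * A)) ^ (n - 1) ≤ r ^ (n - 1) :=
    pow_le_pow_left₀ (by positivity) hr _
  refine le_trans ?_ (mul_le_mul_of_nonneg_left h1 (Real.exp_pos _).le)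
  have hn' : ((n - 1 : ℕ) : ℝ) = n - 1 := by push_cast [Nat.cast_sub (by omega : 1 ≤ n)]; ring
  have hn2 : (2 : ℝ) ≤ n := by exact_mod_cast hn
  have e3 : (3 : ℝ) ^ n = Real.exp (n * Real.log 3) := by
    rw [Real.exp_nat_mul, Real.exp_log (by norm_num)]
  have e18 : (18 : ℝ) = Real.exp (Real.log 2 + 2 * Real.log 3) := by
    rw [Real.exp_add, Real.exp_log (by norm_num), show (2 : ℝ) * Real.log 3 = (2 : ℕ) * Real.log 3 by
      norm_num, Real.exp_nat_mul, Real.exp_log (by norm_num)]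
    norm_num
  rw [e3, e18, ← Real.exp_add, ← Real.exp_add, ← Real.exp_add (Real.log 2 + 2 * Real.log 3),
    ← Real.exp_nat_mul, ← Real.exp_add, hn', Real.exp_le_exp]
  have l2 : 0 < Real.log 2 := Real.log_pos (by norm_num)
  have l3 : 0 < Real.log 3 := Real.log_pos (by norm_num)
  nlinarith [mul_nonneg hA (sub_nonneg.2 hn2), mul_nonneg l2.le (sub_nonneg.2 hn2),
    mul_nonneg l3.le (sub_nonneg.2 hn2)]

theorem random_rotation_intersection :
    ∃ C' : ℝ, 0 < C' ∧
      ∀ (n : ℕ), 2 ≤ n →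
      ∀ (μ : Measure (Matrix.orthogonalGroup (Fin n) ℝ)),
        IsProbabilityMeasure μ → μ.IsMulLeftInvariant →
      ∀ (L : Set (EuclideanSpace ℝ (Fin n))), IsCompact L →
      ∀ A₁ : ℝ,
        (∃ s : Finset (EuclideanSpace ℝ (Fin n)),
          (L ⊆ ⋃ x ∈ s, x +ᵥ Metric.closedBall (0 : EuclideanSpace ℝ (Fin n)) 1) ∧
          (s.card : ℝ) ≤ Real.exp (A₁ * n)) →
        ENNReal.ofReal (1 - Real.exp (-(A₁ + Real.log 2 / 2) * n)) ≤
          μ {U | L ∩ ((fun x => Matrix.toEuclideanLin (U : Matrix (Fin n) (Fin n) ℝ) x) '' L) ⊆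
              Metric.closedBall 0 (C' * Real.exp (6 * A₁))} := by
  refine ⟨21, by norm_num, ?_⟩
  intro n hn μ hμ1 hμ2 L _ A hs
  obtain ⟨s, hLs, hcard⟩ := hs
  set G := {U : Matrix.orthogonalGroup (Fin n) ℝ |
    L ∩ ((fun x => Matrix.toEuclideanLin (U : Matrix (Fin n) (Fin n) ℝ) x) '' L) ⊆
      Metric.closedBall 0 (21 * Real.exp (6 * A))} with hG
  set R := 21 * Real.exp (6 * A) with hR
  -- reduce to a bound on the bad event
  suffices hbad : μ Gᶜ ≤ ENNReal.ofReal (Real.exp (-(A + Real.log 2 / 2) * n)) by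
    rw [ENNReal.ofReal_sub _ (Real.exp_pos _).le, ENNReal.ofReal_one, tsub_le_iff_right]
    calc (1 : ENNReal) = μ (G ∪ Gᶜ) := by rw [Set.union_compl_self, measure_univ]
      _ ≤ μ G + μ Gᶜ := measure_union_le _ _
      _ ≤ _ := by gcongr
  rcases s.eq_empty_or_nonempty with rfl | hne
  · have hL : L = ∅ := by
      apply Set.eq_empty_of_subset_empty
      simpa using hLs
    have : G = Set.univ := by
      apply Set.eq_univ_of_forall
      intro U
      simp [hG, hL]
    simp [this]
  have hA : 0 ≤ A := by
    have h1 : (1 : ℝ) ≤ Real.exp (A * n) :=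
      le_trans (by exact_mod_cast hne.card_pos) hcard
    have h2 : 0 ≤ A * n := Real.one_le_exp_iff.1 h1
    have hn0 : (0 : ℝ) < n := by exact_mod_cast (by omega : 0 < n)
    exact nonneg_of_mul_nonneg_left h2 hn0
  have hexp : 1 ≤ Real.exp (6 * A) := Real.one_le_exp (by linarith)
  set q := 3 ^ n / (R - 3) ^ (n - 1) with hq
  have hR3 : 18 * Real.exp (6 * A) ≤ R - 3 := by rw [hR]; linarith
  have hR0 : 1 ≤ R - 3 := by linarith
  have hcov : ∀ x ∈ L, ∃ z ∈ s, ‖x - z‖ ≤ 1 := by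
    intro x hx
    have := hLs hx
    simp only [Set.mem_iUnion] at this
    obtain ⟨z, hz, hxz⟩ := this
    refine ⟨z, hz, ?_⟩
    obtain ⟨b, hb, rfl⟩ := hxz
    simpa using hb
  let E : EuclideanSpace ℝ (Fin n) → EuclideanSpace ℝ (Fin n) →
      Set (Matrix.orthogonalGroup (Fin n) ℝ) :=
    fun w v => {U | R - 3 ≤ ‖w‖ ∧ ‖rri_act U v - w‖ ≤ 2}
  have hE : ∀ w v, μ (E w v) ≤ ENNReal.ofReal q := by
    intro w v
    by_cases hw : R - 3 ≤ ‖w‖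
    · have h := rri_cap (by omega : 1 ≤ n) μ v w (hR0.trans hw)
      have hpw : 0 < (R - 3) ^ (n - 1) := by positivity
      have h' : μ {U | ‖rri_act U v - w‖ ≤ 2} * ENNReal.ofReal ((R - 3) ^ (n - 1)) ≤
          ENNReal.ofReal (3 ^ n) := by
        refine le_trans ?_ h
        gcongr
      rw [hq, ENNReal.ofReal_div_of_pos hpw, ENNReal.le_div_iff_mul_le]
      · refine le_trans ?_ h'
        gcongr
        intro U hU
        exact hU.2
      · left; simpa using hpw
      · left; exact ENNReal.ofReal_ne_top
    · have : E w v = ∅ := by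
        ext U
        simp only [E, Set.mem_ofPred_eq, Set.mem_empty_iff_false, iff_false]
        exact fun h => hw h.1
      simp [this]
  have hsub : Gᶜ ⊆ ⋃ w ∈ s, ⋃ v ∈ s, E w v := by
    intro U hU
    simp only [hG, Set.mem_compl_iff, Set.mem_ofPred_eq, Set.not_subset] at hU
    obtain ⟨y, ⟨hyL, x, hxL, hxy⟩, hyR⟩ := hU
    have hyx : rri_act U x = y := hxy
    have hyR' : R < ‖y‖ := by simpa using hyR
    obtain ⟨w, hw, hyw⟩ := hcov y hyL
    obtain ⟨v, hv, hxv⟩ := hcov x hxL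
    simp only [Set.mem_iUnion]
    refine ⟨w, hw, v, hv, ?_, ?_⟩
    · have := norm_sub_norm_le y w
      linarith
    · have e : rri_act U v - w = (y - w) - rri_act U (x - v) := by
        rw [rri_act_sub, hyx]; abel
      rw [e]
      refine (norm_sub_le _ _).trans ?_
      rw [rri_norm_act]
      linarith
  have hq0 : 0 ≤ q := by positivity
  calc μ Gᶜ ≤ μ (⋃ w ∈ s, ⋃ v ∈ s, E w v) := measure_mono hsub
    _ ≤ ∑ w ∈ s, μ (⋃ v ∈ s, E w v) := measure_biUnion_finset_le _ _
    _ ≤ ∑ w ∈ s, ∑ v ∈ s, μ (E w v) :=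
        Finset.sum_le_sum fun w _ => measure_biUnion_finset_le _ _
    _ ≤ ∑ w ∈ s, ∑ v ∈ s, ENNReal.ofReal q :=
        Finset.sum_le_sum fun w _ => Finset.sum_le_sum fun v _ => hE w v
    _ = ENNReal.ofReal ((s.card : ℝ) * s.card * q) := by
        simp only [Finset.sum_const, nsmul_eq_mul]
        rw [ENNReal.ofReal_mul (by positivity), ENNReal.ofReal_mul (by positivity),
          ENNReal.ofReal_natCast, mul_assoc]
    _ ≤ ENNReal.ofReal (Real.exp (A * n) * Real.exp (A * n) * q) := by
        gcongr
    _ ≤ _ := ENNReal.ofReal_le_ofReal (rri_num n hn A (R - 3) hA hR3)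
end

section
/- Let Z be a real random variable with log-concave density. Then for 1 ≤ p ≤ q, (E|Z|^q)^{1/q} ≤ C (q/p) (E|Z|^p)^{1/p} for a universal constant C > 0. -/
open MeasureTheory Real

lemma lc_two_point (g : ℝ → ℝ) (hg : ∀ x, 0 ≤ g x)
    (hl : ∀ x y a b : ℝ, 0 ≤ a → 0 ≤ b → a + b = 1 →
          g x ^ a * g y ^ b ≤ g (a * x + b * y)) (u v d : ℝ) (hd : 0 ≤ d) (huv : d ≤ u - v)
    (hpos : v < u) : g u * g v ≤ g (u - d) * g (v + d) := by
  have h0 : 0 < u - v := sub_pos.2 hpos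
  set a := d / (u - v) with ha
  have ha0 : 0 ≤ a := by positivity
  have ha1 : a ≤ 1 := (div_le_one h0).2 huv
  have had : a * (u - v) = d := by rw [ha]; field_simp
  have h1 := hl u v (1 - a) a (by linarith) ha0 (by ring)
  have h2 := hl u v a (1 - a) ha0 (by linarith) (by ring)
  have e1 : (1 - a) * u + a * v = u - d := by rw [← had]; ring
  have e2 : a * u + (1 - a) * v = v + d := by rw [← had]; ring
  rw [e1] at h1
  rw [e2] at h2
  have k : ∀ x : ℝ, 0 ≤ x → x ^ (1 - a) * x ^ a = x := by
    intro x hx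
    rw [← Real.rpow_add' hx (by simp)]
    simp
  calc g u * g v = (g u ^ (1 - a) * g u ^ a) * (g v ^ (1 - a) * g v ^ a) := by
        rw [k _ (hg u), k _ (hg v)]
    _ = (g u ^ (1 - a) * g v ^ a) * (g u ^ a * g v ^ (1 - a)) := by ring
    _ ≤ _ := mul_le_mul h1 h2
        (mul_nonneg (Real.rpow_nonneg (hg _) _) (Real.rpow_nonneg (hg _) _)) (hg _)

lemma lc_measurable (g : ℝ → ℝ) (hg : ∀ x, 0 ≤ g x)
    (hl : ∀ x y a b : ℝ, 0 ≤ a → 0 ≤ b → a + b = 1 →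
          g x ^ a * g y ^ b ≤ g (a * x + b * y)) : Measurable g := by
  apply measurable_of_Ici
  intro t
  by_cases ht : t ≤ 0
  · have : g ⁻¹' Set.Ici t = Set.univ := by
      ext x; simpa using ht.trans (hg x)
    rw [this]; exact MeasurableSet.univ
  · push Not at ht
    have hc : Convex ℝ (g ⁻¹' Set.Ici t) := by
      intro x hx y hy a b ha hb hab
      simp only [Set.mem_preimage, Set.mem_Ici, smul_eq_mul] at *
      refine le_trans ?_ (hl x y a b ha hb hab)
      calc t = t ^ a * t ^ b := by rw [← Real.rpow_add ht, hab, Real.rpow_one]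
        _ ≤ _ := mul_le_mul (Real.rpow_le_rpow ht.le hx ha) (Real.rpow_le_rpow ht.le hy hb)
            (Real.rpow_nonneg ht.le _) (Real.rpow_nonneg (hg _) _)
    exact hc.ordConnected.measurableSet

lemma lc_shift (f : ℝ → ENNReal) (a b d : ℝ) :
    ∫⁻ x in Set.Ioc (a + d) (b + d), f (x - d) = ∫⁻ x in Set.Ioc a b, f x := by
  have h := (measurePreserving_sub_right (volume : Measure ℝ) d).setLIntegral_comp_preimage_emb
    (MeasurableEquiv.subRight d).measurableEmbedding f (Set.Ioc a b)
  rw [← h]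
  congr 2
  ext x; simp

lemma lc_tail (g : ℝ → ℝ) (hg : ∀ x, 0 ≤ g x)
    (hl : ∀ x y a b : ℝ, 0 ≤ a → 0 ≤ b → a + b = 1 →
          g x ^ a * g y ^ b ≤ g (a * x + b * y)) (A l : ℝ) (hA : 0 < A) (hl0 : 0 ≤ l)
    (m0 m1 : ENNReal)
    (h0 : ∫⁻ x in Set.Ioc (-A) A, ENNReal.ofReal (g x) = m0)
    (h1 : ∫⁻ x in Set.Ioi A, ENNReal.ofReal (g x) = m1)
    (hm0 : m0 ≠ 0) (hm0' : m0 ≠ ⊤) (hm1 : m1 ≤ 1)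
    (hr : 2 * (m1 * ENNReal.ofReal (exp (l * (2 * A)))) ≤ m0) :
    ∫⁻ x in Set.Ioi A, ENNReal.ofReal (exp (l * x)) * ENNReal.ofReal (g x)
      ≤ 2 * ENNReal.ofReal (exp (l * (3 * A))) := by
  have hgm := lc_measurable g hg hl
  have hpt : ∀ u, 3 * A < u → ENNReal.ofReal (g u) * m0 ≤ ENNReal.ofReal (g (u - 2 * A)) * m1 := by
    intro u hu
    calc ENNReal.ofReal (g u) * m0
        = ∫⁻ x in Set.Ioc (-A) A, ENNReal.ofReal (g u) * ENNReal.ofReal (g x) := by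
          rw [lintegral_const_mul _ hgm.ennreal_ofReal, h0]
      _ ≤ ∫⁻ x in Set.Ioc (-A) A,
            ENNReal.ofReal (g (u - 2 * A)) * ENNReal.ofReal (g (x + 2 * A)) := by
          apply setLIntegral_mono' measurableSet_Ioc
          intro x hx
          rw [← ENNReal.ofReal_mul (hg _), ← ENNReal.ofReal_mul (hg _)]
          apply ENNReal.ofReal_le_ofReal
          exact lc_two_point g hg hl u x (2 * A) (by linarith) (by linarith [hx.2])
            (by linarith [hx.2])
      _ = ENNReal.ofReal (g (u - 2 * A)) *
            ∫⁻ x in Set.Ioc (-A) A, ENNReal.ofReal (g (x + 2 * A)) := by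
          rw [lintegral_const_mul]
          exact (hgm.comp (measurable_add_const _)).ennreal_ofReal
      _ ≤ _ := by
          gcongr
          rw [← h1]
          have := lc_shift (fun x => ENNReal.ofReal (g x)) A (A + 2 * A) (-(2 * A))
          have e1 : A + -(2 * A) = -A := by ring
          have e2 : A + 2 * A + -(2 * A) = A := by ring
          simp only [e1, e2, sub_neg_eq_add] at this
          rw [this]
          exact lintegral_mono_set Set.Ioc_subset_Ioi_self
  set F : ℝ → ENNReal := fun x => ENNReal.ofReal (exp (l * x)) * ENNReal.ofReal (g x) with hF
  have hFm : Measurable F := by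
    apply Measurable.mul _ hgm.ennreal_ofReal
    fun_prop
  have hbd : ∀ N : ℝ, ∫⁻ x in Set.Ioc A N, F x ≤ ENNReal.ofReal (exp (l * N)) * m1 := by
    intro N
    calc ∫⁻ x in Set.Ioc A N, F x
        ≤ ∫⁻ x in Set.Ioc A N, ENNReal.ofReal (exp (l * N)) * ENNReal.ofReal (g x) := by
          apply setLIntegral_mono' measurableSet_Ioc
          intro x hx
          simp only [hF]
          gcongr
          exact hx.2
      _ = ENNReal.ofReal (exp (l * N)) * ∫⁻ x in Set.Ioc A N, ENNReal.ofReal (g x) :=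
          lintegral_const_mul _ hgm.ennreal_ofReal
      _ ≤ _ := by
          gcongr
          rw [← h1]
          exact lintegral_mono_set Set.Ioc_subset_Ioi_self
  have hJ : ∀ N : ℝ, ∫⁻ x in Set.Ioc A N, F x ≤ 2 * ENNReal.ofReal (exp (l * (3 * A))) := by
    intro N
    set J := ∫⁻ x in Set.Ioc A N, F x with hJdef
    have hJfin : J ≠ ⊤ := by
      refine ne_top_of_le_ne_top ?_ (hbd N)
      exact ENNReal.mul_ne_top ENNReal.ofReal_ne_top (ne_top_of_le_ne_top ENNReal.one_ne_top hm1)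
    set K := ∫⁻ x in Set.Ioc (3 * A) N, F x with hKdef
    have hsplit : J ≤ ENNReal.ofReal (exp (l * (3 * A))) + K := by
      calc J ≤ ∫⁻ x in Set.Ioc A (3 * A) ∪ Set.Ioc (3 * A) N, F x :=
            lintegral_mono_set Set.Ioc_subset_Ioc_union_Ioc
        _ ≤ (∫⁻ x in Set.Ioc A (3 * A), F x) + K := lintegral_union_le _ _ _
        _ ≤ _ := by
            gcongr
            refine (hbd _).trans ?_
            exact mul_le_of_le_one_right' hm1
    have hK : K * m0 ≤ J * (m1 * ENNReal.ofReal (exp (l * (2 * A)))) := by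
      calc K * m0 = ∫⁻ x in Set.Ioc (3 * A) N, F x * m0 := (lintegral_mul_const _ hFm).symm
        _ ≤ ∫⁻ x in Set.Ioc (3 * A) N,
              F (x - 2 * A) * (m1 * ENNReal.ofReal (exp (l * (2 * A)))) := by
            apply setLIntegral_mono' measurableSet_Ioc
            intro x hx
            have e : exp (l * x) = exp (l * (x - 2 * A)) * exp (l * (2 * A)) := by
              rw [← Real.exp_add]; ring_nf
            simp only [hF]
            rw [e, ENNReal.ofReal_mul (exp_pos _).le]
            calc _ = ENNReal.ofReal (exp (l * (x - 2 * A))) * ENNReal.ofReal (exp (l * (2 * A)))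
                  * (ENNReal.ofReal (g x) * m0) := by ring
              _ ≤ ENNReal.ofReal (exp (l * (x - 2 * A))) * ENNReal.ofReal (exp (l * (2 * A)))
                  * (ENNReal.ofReal (g (x - 2 * A)) * m1) := by
                  exact mul_le_mul' le_rfl (hpt x hx.1)
              _ = _ := by ring
        _ = (∫⁻ x in Set.Ioc (3 * A) N, F (x - 2 * A)) *
              (m1 * ENNReal.ofReal (exp (l * (2 * A)))) :=
            lintegral_mul_const _ (hFm.comp (measurable_sub_const _))
        _ ≤ _ := by
            gcongr
            have := lc_shift F A (N - 2 * A) (2 * A)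
            have e1 : A + 2 * A = 3 * A := by ring
            have e2 : N - 2 * A + 2 * A = N := by ring
            rw [e1, e2] at this
            rw [this]
            exact lintegral_mono_set (Set.Ioc_subset_Ioc_right (by linarith))
    have hK2 : 2 * K ≤ J := by
      have : (2 * K) * m0 ≤ J * m0 := by
        calc (2 * K) * m0 = 2 * (K * m0) := by ring
          _ ≤ 2 * (J * (m1 * ENNReal.ofReal (exp (l * (2 * A))))) := by gcongr
          _ = J * (2 * (m1 * ENNReal.ofReal (exp (l * (2 * A))))) := by ring
          _ ≤ _ := by gcongr
      exact (ENNReal.mul_le_mul_iff_left hm0 hm0').1 this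
    have h2 : J + J ≤ 2 * ENNReal.ofReal (exp (l * (3 * A))) + J := by
      calc J + J = 2 * J := (two_mul _).symm
        _ ≤ 2 * (ENNReal.ofReal (exp (l * (3 * A))) + K) := by gcongr
        _ = 2 * ENNReal.ofReal (exp (l * (3 * A))) + 2 * K := by ring
        _ ≤ _ := by gcongr
    exact (ENNReal.add_le_add_iff_right hJfin).1 h2
  have hU : Set.Ioi A = ⋃ n : ℕ, Set.Ioc A (n : ℝ) := by
    ext x
    simp only [Set.mem_Ioi, Set.mem_iUnion, Set.mem_Ioc]
    constructor
    · intro h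
      obtain ⟨n, hn⟩ := exists_nat_ge x
      exact ⟨n, h, hn⟩
    · rintro ⟨n, h, _⟩; exact h
  rw [hU, setLIntegral_iUnion_of_directed]
  · exact iSup_le fun n => hJ n
  · apply Monotone.directed_le
    intro m n hmn
    exact Set.Ioc_subset_Ioc_right (by exact_mod_cast hmn)

lemma lc_half (g : ℝ → ℝ) (hg : ∀ x, 0 ≤ g x)
    (hl : ∀ x y a b : ℝ, 0 ≤ a → 0 ≤ b → a + b = 1 →
          g x ^ a * g y ^ b ≤ g (a * x + b * y)) (A l : ℝ) (hA : 0 < A) (hl0 : 0 ≤ l)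
    (D : ENNReal) (hint : ∫⁻ x, ENNReal.ofReal (g x) = 1)
    (hD : ∫⁻ x in {x : ℝ | A ≤ |x|}, ENNReal.ofReal (g x) ≤ D) (hD1 : D < 1)
    (hr : 2 * (D * ENNReal.ofReal (exp (l * (2 * A)))) + D ≤ 1) :
    ∫⁻ x in Set.Ioi A, ENNReal.ofReal (exp (l * |x|)) * ENNReal.ofReal (g x)
      ≤ 2 * ENNReal.ofReal (exp (l * (3 * A))) := by
  have hm1 : ∫⁻ x in Set.Ioi A, ENNReal.ofReal (g x) ≤ D := by
    refine le_trans (lintegral_mono_set ?_) hD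
    intro x hx
    exact (le_of_lt hx).trans (le_abs_self x)
  have hcov : 1 ≤ (∫⁻ x in Set.Ioc (-A) A, ENNReal.ofReal (g x)) + D := by
    calc 1 = ∫⁻ x in Set.univ, ENNReal.ofReal (g x) := by rw [setLIntegral_univ, hint]
      _ ≤ ∫⁻ x in Set.Ioc (-A) A ∪ {x : ℝ | A ≤ |x|}, ENNReal.ofReal (g x) := by
          apply lintegral_mono_set
          intro x _
          by_cases h : A ≤ |x|
          · right; exact h
          · left
            push Not at h
            exact ⟨(abs_lt.1 h).1, (abs_lt.1 h).2.le⟩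
      _ ≤ _ := (lintegral_union_le _ _ _).trans (by gcongr)
  have hDt : D ≠ ⊤ := ne_top_of_lt hD1
  have key := lc_tail g hg hl A l hA hl0 _ _ rfl rfl ?_ ?_ (hm1.trans hD1.le) ?_
  · refine le_trans (le_of_eq ?_) key
    apply setLIntegral_congr_fun measurableSet_Ioi
    intro x hx
    simp only
    rw [abs_of_pos (hA.trans hx)]
  · intro h
    rw [h, zero_add] at hcov
    exact absurd hcov (not_le.2 hD1)
  · refine ne_top_of_le_ne_top ENNReal.one_ne_top ?_
    rw [← hint]
    exact setLIntegral_le_lintegral _ _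
  · refine le_trans ?_ ((ENNReal.add_le_add_iff_right hDt).1 (hr.trans hcov))
    gcongr

lemma lc_neg (f : ℝ → ENNReal) (s : Set ℝ) :
    ∫⁻ x in Neg.neg ⁻¹' s, f (-x) = ∫⁻ x in s, f x :=
  (Measure.measurePreserving_neg (volume : Measure ℝ)).setLIntegral_comp_preimage_emb
    (MeasurableEquiv.neg ℝ).measurableEmbedding f s

lemma lc_full (g : ℝ → ℝ) (hg : ∀ x, 0 ≤ g x)
    (hl : ∀ x y a b : ℝ, 0 ≤ a → 0 ≤ b → a + b = 1 →
          g x ^ a * g y ^ b ≤ g (a * x + b * y)) (A l : ℝ) (hA : 0 < A) (hl0 : 0 ≤ l)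
    (D : ENNReal) (hint : ∫⁻ x, ENNReal.ofReal (g x) = 1)
    (hD : ∫⁻ x in {x : ℝ | A ≤ |x|}, ENNReal.ofReal (g x) ≤ D) (hD1 : D < 1)
    (hr : 2 * (D * ENNReal.ofReal (exp (l * (2 * A)))) + D ≤ 1) :
    ∫⁻ x, ENNReal.ofReal (exp (l * |x|)) * ENNReal.ofReal (g x)
      ≤ 5 * ENNReal.ofReal (exp (l * (3 * A))) := by
  have hgm := lc_measurable g hg hl
  have R := lc_half g hg hl A l hA hl0 D hint hD hD1 hr
  have L := lc_half (fun x => g (-x)) (fun x => hg _) (by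
      intro x y a b ha hb hab
      have := hl (-x) (-y) a b ha hb hab
      have e : a * -x + b * -y = -(a * x + b * y) := by ring
      rwa [e] at this) A l hA hl0 D (by
      have := lc_neg (fun x => ENNReal.ofReal (g x)) Set.univ
      rw [Set.preimage_univ, setLIntegral_univ, setLIntegral_univ] at this
      rw [this, hint]) (by
      have := lc_neg (fun x => ENNReal.ofReal (g x)) {x : ℝ | A ≤ |x|}
      have e : Neg.neg ⁻¹' {x : ℝ | A ≤ |x|} = {x : ℝ | A ≤ |x|} := by ext x; simp
      rw [e] at this
      rw [this]; exact hD) hD1 hr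
  have L2 : ∫⁻ x in Set.Iio (-A), ENNReal.ofReal (exp (l * |x|)) * ENNReal.ofReal (g x)
      ≤ 2 * ENNReal.ofReal (exp (l * (3 * A))) := by
    rw [← lc_neg]
    have e : Neg.neg ⁻¹' Set.Iio (-A) = Set.Ioi A := by ext x; simp
    rw [e]
    simpa only [abs_neg] using L
  have Mid : ∫⁻ x in Set.Icc (-A) A, ENNReal.ofReal (exp (l * |x|)) * ENNReal.ofReal (g x)
      ≤ ENNReal.ofReal (exp (l * (3 * A))) := by
    calc _ ≤ ∫⁻ x in Set.Icc (-A) A,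
          ENNReal.ofReal (exp (l * (3 * A))) * ENNReal.ofReal (g x) := by
          apply setLIntegral_mono' measurableSet_Icc
          intro x hx
          have : |x| ≤ 3 * A := (abs_le.2 hx).trans (by linarith)
          gcongr
      _ ≤ ∫⁻ x, ENNReal.ofReal (exp (l * (3 * A))) * ENNReal.ofReal (g x) :=
          setLIntegral_le_lintegral _ _
      _ = _ := by rw [lintegral_const_mul _ hgm.ennreal_ofReal, hint, mul_one]
  calc _ = ∫⁻ x in Set.univ, ENNReal.ofReal (exp (l * |x|)) * ENNReal.ofReal (g x) := by
        rw [setLIntegral_univ]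
    _ ≤ ∫⁻ x in Set.Icc (-A) A ∪ (Set.Ioi A ∪ Set.Iio (-A)),
          ENNReal.ofReal (exp (l * |x|)) * ENNReal.ofReal (g x) := by
        apply lintegral_mono_set
        intro x _
        by_cases h : A < x
        · right; left; exact h
        · by_cases h' : x < -A
          · right; right; exact h'
          · left; exact ⟨not_lt.1 h', not_lt.1 h⟩
    _ ≤ ENNReal.ofReal (exp (l * (3 * A))) + (2 * ENNReal.ofReal (exp (l * (3 * A)))
          + 2 * ENNReal.ofReal (exp (l * (3 * A)))) := by
        refine (lintegral_union_le _ _ _).trans (add_le_add Mid ?_)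
        exact (lintegral_union_le _ _ _).trans (add_le_add R L2)
    _ = _ := by ring

lemma lc_numeric (p : ℝ) (hp : 1 ≤ p) :
    2 * ((10 : ℝ) ^ (-p) * exp p) + (10 : ℝ) ^ (-p) ≤ 1 := by
  have he := Real.exp_one_lt_d9
  have e1 : (10 : ℝ) ^ (-p) ≤ 1 / 10 := by
    calc (10 : ℝ) ^ (-p) ≤ 10 ^ (-1 : ℝ) :=
          Real.rpow_le_rpow_of_exponent_le (by norm_num) (by linarith)
      _ = 1 / 10 := by rw [Real.rpow_neg_one]; norm_num
  have e2 : (10 : ℝ) ^ (-p) * exp p ≤ 3 / 10 := by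
    have : (10 : ℝ) ^ (-p) * exp p = (exp 1 / 10) ^ p := by
      rw [Real.div_rpow (exp_pos _).le (by norm_num), Real.exp_one_rpow,
        Real.rpow_neg (by norm_num)]
      field_simp
    rw [this]
    calc (exp 1 / 10) ^ p ≤ (exp 1 / 10) ^ (1 : ℝ) :=
          Real.rpow_le_rpow_of_exponent_ge (by positivity) (by linarith) hp
      _ ≤ _ := by rw [Real.rpow_one]; linarith
  linarith

theorem logconcave_moment_comparison :
    ∃ C : ℝ, 0 < C ∧
      ∀ (Ω : Type) (_ : MeasurableSpace Ω) (ℙ : Measure Ω), IsProbabilityMeasure ℙ →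
      ∀ (Z : Ω → ℝ), Measurable Z →
      ∀ g : ℝ → ℝ, (∀ x, 0 ≤ g x) →
        (∀ x y a b : ℝ, 0 ≤ a → 0 ≤ b → a + b = 1 →
          g x ^ a * g y ^ b ≤ g (a * x + b * y)) →
        Measure.map Z ℙ = volume.withDensity (fun x => ENNReal.ofReal (g x)) →
      ∀ p q : ℝ, 1 ≤ p → p ≤ q →
        (∫ ω, |Z ω| ^ q ∂ℙ) ^ (1 / q) ≤ C * (q / p) * (∫ ω, |Z ω| ^ p ∂ℙ) ^ (1 / p) := by
  refine ⟨20 * exp 4, by positivity, ?_⟩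
  intro Ω _ ℙ hℙ Z hZ g hg hl hmap p q hp hpq
  have hgm := lc_measurable g hg hl
  have hp0 : 0 < p := by linarith
  have hq0 : 0 < q := by linarith
  have hI0 : 0 ≤ ∫ ω, |Z ω| ^ p ∂ℙ := integral_nonneg fun ω => by positivity
  have hrhs : 0 ≤ 20 * exp 4 * (q / p) * (∫ ω, |Z ω| ^ p ∂ℙ) ^ (1 / p) := by positivity
  have hzero : (0 : ℝ) ^ (1 / q) = 0 := Real.zero_rpow (by positivity)
  by_cases hiq : Integrable (fun ω => |Z ω| ^ q) ℙ
  swap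
  · rw [integral_undef hiq, hzero]; exact hrhs
  have hip : Integrable (fun ω => |Z ω| ^ p) ℙ := by
    refine Integrable.mono' (hiq.add (integrable_const (1 : ℝ)))
      (Measurable.aestronglyMeasurable (by measurability)) ?_
    filter_upwards with ω
    rw [Real.norm_of_nonneg (by positivity)]
    simp only [Pi.add_apply]
    rcases le_total |Z ω| 1 with h | h
    · have h1 : |Z ω| ^ p ≤ 1 := Real.rpow_le_one (abs_nonneg _) h hp0.le
      have h2 : 0 ≤ |Z ω| ^ q := by positivity
      linarith
    · have := Real.rpow_le_rpow_of_exponent_le h hpq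
      linarith
  rcases hI0.eq_or_lt with hI | hI
  · have h0 := (integral_eq_zero_iff_of_nonneg (fun ω => by positivity) hip).1 hI.symm
    have : ∫ ω, |Z ω| ^ q ∂ℙ = 0 := by
      rw [integral_eq_zero_iff_of_nonneg (fun ω => by positivity) hiq]
      filter_upwards [h0] with ω hω
      simp only [Pi.zero_apply] at *
      have := (Real.rpow_eq_zero (abs_nonneg _) hp0.ne').1 hω
      rw [this, Real.zero_rpow hq0.ne']
    rw [this, hzero]; exact hrhs
  set I := ∫ ω, |Z ω| ^ p ∂ℙ with hIdef
  set M := I ^ (1 / p) with hM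
  have hM0 : 0 < M := Real.rpow_pos_of_pos hI _
  have hMp : M ^ p = I := by
    rw [hM, ← Real.rpow_mul hI.le, one_div_mul_cancel hp0.ne', Real.rpow_one]
  set A := 10 * M with hA
  have hA0 : 0 < A := by positivity
  set l := p / (2 * A) with hldef
  have hl0 : 0 < l := by positivity
  have hlA : l * (2 * A) = p := by rw [hldef]; field_simp
  -- change of variables
  have hcv : ∀ f : ℝ → ENNReal, Measurable f →
      ∫⁻ ω, f (Z ω) ∂ℙ = ∫⁻ x, f x * ENNReal.ofReal (g x) := by
    intro f hf
    rw [← lintegral_map hf hZ, hmap,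
      lintegral_withDensity_eq_lintegral_mul _ hgm.ennreal_ofReal hf]
    simp only [Pi.mul_apply, mul_comm]
  have hint : ∫⁻ x, ENNReal.ofReal (g x) = 1 := by
    have := hcv (fun _ => 1) measurable_const
    simpa using this.symm
  have hms : MeasurableSet {x : ℝ | A ≤ |x|} := measurableSet_le measurable_const (by fun_prop)
  have hmark : ∫⁻ x in {x : ℝ | A ≤ |x|}, ENNReal.ofReal (g x)
      ≤ ENNReal.ofReal ((10 : ℝ) ^ (-p)) := by
    rw [← withDensity_apply _ hms, ← hmap, Measure.map_apply hZ hms]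
    have h1 := mul_meas_ge_le_integral_of_nonneg (μ := ℙ) (f := fun ω => |Z ω| ^ p)
      (Filter.Eventually.of_forall fun ω => by positivity) hip (A ^ p)
    have e : {ω | A ^ p ≤ |Z ω| ^ p} = Z ⁻¹' {x : ℝ | A ≤ |x|} := by
      ext ω
      simp only [Set.mem_ofPred_eq, Set.mem_preimage]
      exact Real.rpow_le_rpow_iff hA0.le (abs_nonneg _) hp0
    rw [e, ← hIdef, hA, Real.mul_rpow (by norm_num) hM0.le, hMp] at h1
    rw [← ENNReal.ofReal_toReal (measure_ne_top ℙ _)]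
    apply ENNReal.ofReal_le_ofReal
    change ℙ.real _ ≤ _
    rw [Real.rpow_neg (by norm_num), ← one_div, le_div_iff₀ (by positivity)]
    refine le_of_mul_le_mul_right ?_ hI
    calc _ = _ := by ring
      _ ≤ _ := h1
      _ = _ := by ring
  have hnum := lc_numeric p hp
  have hfull := lc_full g hg hl A l hA0 hl0.le _ hint hmark (by
      rw [ENNReal.ofReal_lt_one]
      exact Real.rpow_lt_one_of_one_lt_of_neg (by norm_num) (by linarith)) (by
      rw [hlA, ← ENNReal.ofReal_mul (by positivity)]
      rw [← ENNReal.ofReal_ofNat 2, ← ENNReal.ofReal_mul (by norm_num),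
        ← ENNReal.ofReal_add (by positivity) (by positivity)]
      exact ENNReal.ofReal_le_one.2 hnum)
  rw [← hcv (fun x => ENNReal.ofReal (exp (l * |x|))) (by fun_prop)] at hfull
  have hpt : ∀ x : ℝ, |x| ^ q ≤ (q / l) ^ q * exp (l * |x|) := by
    intro x
    have h1 : l * |x| / q ≤ exp (l * |x| / q) := by
      linarith [Real.add_one_le_exp (l * |x| / q)]
    have h2 : |x| = (q / l) * (l * |x| / q) := by field_simp
    calc |x| ^ q = ((q / l) * (l * |x| / q)) ^ q := by rw [← h2]
      _ ≤ ((q / l) * exp (l * |x| / q)) ^ q := by gcongr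
      _ = (q / l) ^ q * exp (l * |x|) := by
          rw [Real.mul_rpow (by positivity) (exp_pos _).le, ← Real.exp_mul]
          congr 2
          field_simp
  have hbound : ∫ ω, |Z ω| ^ q ∂ℙ ≤ (q / l) ^ q * (5 * exp (l * (3 * A))) := by
    rw [integral_eq_lintegral_of_nonneg_ae (Filter.Eventually.of_forall fun ω => by positivity)
      hiq.aestronglyMeasurable]
    apply ENNReal.toReal_le_of_le_ofReal (by positivity)
    calc ∫⁻ ω, ENNReal.ofReal (|Z ω| ^ q) ∂ℙ
        ≤ ∫⁻ ω, ENNReal.ofReal ((q / l) ^ q) * ENNReal.ofReal (exp (l * |Z ω|)) ∂ℙ := by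
          apply lintegral_mono
          intro ω
          simp only
          rw [← ENNReal.ofReal_mul (by positivity)]
          exact ENNReal.ofReal_le_ofReal (hpt _)
      _ = ENNReal.ofReal ((q / l) ^ q) * ∫⁻ ω, ENNReal.ofReal (exp (l * |Z ω|)) ∂ℙ :=
          lintegral_const_mul _ (by fun_prop)
      _ ≤ ENNReal.ofReal ((q / l) ^ q) * (5 * ENNReal.ofReal (exp (l * (3 * A)))) := by
          gcongr
      _ = _ := by
          rw [← ENNReal.ofReal_ofNat 5, ← ENNReal.ofReal_mul (by norm_num),
            ← ENNReal.ofReal_mul (by positivity)]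
  have h5 : 5 * exp (l * (3 * A)) ≤ exp 4 ^ q := by
    have e : l * (3 * A) = 3 / 2 * p := by rw [← hlA]; ring
    have h2 : (5 : ℝ) ≤ exp 2 := by
      have h1 := Real.exp_one_gt_d9
      have : exp 2 = exp 1 * exp 1 := by rw [← Real.exp_add]; norm_num
      rw [this]; nlinarith
    rw [e, ← Real.exp_mul]
    calc 5 * exp (3 / 2 * p) ≤ exp 2 * exp (3 / 2 * p) := by gcongr
      _ = exp (2 + 3 / 2 * p) := (Real.exp_add _ _).symm
      _ ≤ _ := by gcongr; linarith
  calc (∫ ω, |Z ω| ^ q ∂ℙ) ^ (1 / q) ≤ ((q / l * exp 4) ^ q) ^ (1 / q) := by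
        apply Real.rpow_le_rpow (integral_nonneg fun ω => by positivity) _ (by positivity)
        rw [Real.mul_rpow (by positivity) (exp_pos _).le]
        exact hbound.trans (by gcongr)
    _ = q / l * exp 4 := by
        rw [← Real.rpow_mul (by positivity), mul_one_div_cancel hq0.ne', Real.rpow_one]
    _ = 20 * exp 4 * (q / p) * M := by
        rw [hldef, hA]; field_simp; norm_num
end
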